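/- arXiv:2210.01722 — 5 statements merged into one kernel-verified Lean document; each statement's English description precedes it below -/
import Mathlib

section
/- Let n ≥ 3 and let f_i(x) = xᵀA_ix + 2b_iᵀx + c_i, i ∈ [m], be quadratic functions on ℝⁿ with S = {x ∈ ℝⁿ : f_i(x) < 0 for all i ∈ [m]}. Suppose the associated homogeneous quadratic map f^h : ℝ^{n+1} → ℝᵐ satisfies hidden hyperplane convexity. If S ≠ ∅ and conv(S) ≠ ℝⁿ, then conv(S) = ⋂_{λ∈Ω} S_λ. -/
open Matrix Set

noncomputable section

/-- The value of the quadratic function `xᵀ A x + 2 bᵀ x + c`. -/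
def qf {n : ℕ} (A : Matrix (Fin n) (Fin n) ℝ) (b : Fin n → ℝ) (c : ℝ) (x : Fin n → ℝ) : ℝ :=
  x ⬝ᵥ A.mulVec x + 2 * (b ⬝ᵥ x) + c

/-- The bordered `(n+1)×(n+1)` matrix `[[A, b], [bᵀ, c]]`. -/
def Qmat {n : ℕ} (A : Matrix (Fin n) (Fin n) ℝ) (b : Fin n → ℝ) (c : ℝ) :
    Matrix (Fin n ⊕ Unit) (Fin n ⊕ Unit) ℝ :=
  Matrix.fromBlocks A (Matrix.of fun i _ => b i) (Matrix.of fun _ j => b j)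
    (Matrix.of fun _ _ => c)

/-- A linear hyperplane: the kernel of a nonzero linear functional. -/
def IsLinearHyperplane {V : Type*} [AddCommGroup V] [Module ℝ V] (H : Submodule ℝ V) : Prop :=
  ∃ φ : V →ₗ[ℝ] ℝ, φ ≠ 0 ∧ H = LinearMap.ker φ

/-- Image of a set under the quadratic map associated to the family `Q`. -/
def quadImage {ι κ : Type*} [Fintype ι] (Q : κ → Matrix ι ι ℝ) (U : Set (ι → ℝ)) :
    Set (κ → ℝ) :=
  (fun x k => x ⬝ᵥ (Q k).mulVec x) '' U

/-- Hidden hyperplane convexity: the image of every linear hyperplane under the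
quadratic map is convex. -/
def HHC {ι κ : Type*} [Fintype ι] (Q : κ → Matrix ι ι ℝ) : Prop :=
  ∀ H : Submodule ℝ (ι → ℝ), IsLinearHyperplane H →
    Convex ℝ (quadImage Q (H : Set (ι → ℝ)))

/-- `Q` has at most one negative eigenvalue, counted with multiplicity. -/
def NegEigsAtMostOne {ι : Type*} [Fintype ι] [DecidableEq ι] (Q : Matrix ι ι ℝ) : Prop :=
  ∃ hQ : Q.IsHermitian, (Finset.univ.filter fun i => hQ.eigenvalues i < 0).card ≤ 1

/-- The set `S` defined by the strict quadratic inequalities. -/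
def Sset {n m : ℕ} (A : Fin m → Matrix (Fin n) (Fin n) ℝ) (b : Fin m → Fin n → ℝ)
    (c : Fin m → ℝ) : Set (Fin n → ℝ) :=
  {x | ∀ i, qf (A i) (b i) (c i) x < 0}

/-- The set defined by the aggregated inequality with weights `lam`. -/
def Sagg {n m : ℕ} (A : Fin m → Matrix (Fin n) (Fin n) ℝ) (b : Fin m → Fin n → ℝ)
    (c : Fin m → ℝ) (lam : Fin m → ℝ) : Set (Fin n → ℝ) :=
  {x | ∑ i, lam i * qf (A i) (b i) (c i) x < 0}

/-- The set `Ω` of good aggregations. -/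
def Omega {n m : ℕ} (A : Fin m → Matrix (Fin n) (Fin n) ℝ) (b : Fin m → Fin n → ℝ)
    (c : Fin m → ℝ) : Set (Fin m → ℝ) :=
  {lam | 0 ≤ lam ∧ lam ≠ 0 ∧ convexHull ℝ (Sset A b c) ⊆ Sagg A b c lam ∧
    NegEigsAtMostOne (∑ i, lam i • Qmat (A i) (b i) (c i))}

/-- Expansion of a symmetric quadratic form on a linear combination of two vectors. -/
lemma quad_smul_add_smul {ι : Type*} [Fintype ι] {Q : Matrix ι ι ℝ} (hQ : Q.IsSymm)
    (u v : ι → ℝ) (a b : ℝ) :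
    (a • u + b • v) ⬝ᵥ Q.mulVec (a • u + b • v) =
      a ^ 2 * (u ⬝ᵥ Q.mulVec u) + 2 * a * b * (u ⬝ᵥ Q.mulVec v) +
        b ^ 2 * (v ⬝ᵥ Q.mulVec v) := by
  have hsymm : v ⬝ᵥ Q.mulVec u = u ⬝ᵥ Q.mulVec v := by
    rw [Matrix.dotProduct_mulVec, ← Matrix.mulVec_transpose, hQ.eq, dotProduct_comm]
  simp only [Matrix.mulVec_add, Matrix.mulVec_smul, add_dotProduct, dotProduct_add,
    smul_dotProduct, dotProduct_smul, smul_eq_mul, hsymm]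
  ring

/-- If a symmetric form is nonnegative on the hyperplane `φ = 0`, then its negative cone
intersected with the half-space `φ < 0` is closed under convex combinations. -/
lemma quad_neg_of_nonneg_on_ker {ι : Type*} [Fintype ι] {Q : Matrix ι ι ℝ} (hQ : Q.IsSymm)
    (φ : (ι → ℝ) →ₗ[ℝ] ℝ) (hφ : ∀ w, φ w = 0 → 0 ≤ w ⬝ᵥ Q.mulVec w)
    {u v : ι → ℝ} (hu : φ u < 0) (hv : φ v < 0)
    (hqu : u ⬝ᵥ Q.mulVec u < 0) (hqv : v ⬝ᵥ Q.mulVec v < 0)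
    {a b : ℝ} (ha : 0 ≤ a) (hb : 0 ≤ b) (hab : a + b = 1) :
    (a • u + b • v) ⬝ᵥ Q.mulVec (a • u + b • v) < 0 := by
  have hw := hφ (φ v • u + (-φ u) • v) (by simp; ring)
  rw [quad_smul_add_smul hQ] at hw ⊢
  have hcross : u ⬝ᵥ Q.mulVec v < 0 := by
    have h1 : φ v ^ 2 * (u ⬝ᵥ Q.mulVec u) < 0 := mul_neg_of_pos_of_neg (sq_pos_of_neg hv) hqu
    have h2 : (-φ u) ^ 2 * (v ⬝ᵥ Q.mulVec v) < 0 :=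
      mul_neg_of_pos_of_neg (sq_pos_of_pos (neg_pos.2 hu)) hqv
    have h3 : 0 < φ u * φ v := mul_pos_of_neg_of_neg hu hv
    by_contra! h
    nlinarith [mul_nonneg h3.le h]
  have h2 : 2 * a * b * (u ⬝ᵥ Q.mulVec v) ≤ 0 :=
    mul_nonpos_of_nonneg_of_nonpos (by positivity) hcross.le
  have h3 : b ^ 2 * (v ⬝ᵥ Q.mulVec v) ≤ 0 :=
    mul_nonpos_of_nonneg_of_nonpos (by positivity) hqv.le
  rcases ha.eq_or_lt with rfl | ha'
  · have : b = 1 := by linarith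
    subst this
    linarith
  · have h1 : a ^ 2 * (u ⬝ᵥ Q.mulVec u) < 0 := mul_neg_of_pos_of_neg (by positivity) hqu
    linarith

/-- A symmetric form that is nonnegative on a hyperplane has at most one negative eigenvalue. -/
lemma negEigsAtMostOne_of_nonneg_on_ker {ι : Type*} [Fintype ι] [DecidableEq ι]
    {Q : Matrix ι ι ℝ} (hQ : Q.IsSymm) (φ : (ι → ℝ) →ₗ[ℝ] ℝ)
    (hφ : ∀ w, φ w = 0 → 0 ≤ w ⬝ᵥ Q.mulVec w) : NegEigsAtMostOne Q := by
  have hH : Q.IsHermitian := by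
    rw [Matrix.IsHermitian, Matrix.conjTranspose_eq_transpose_of_trivial, hQ.eq]
  refine ⟨hH, Finset.card_le_one.2 fun i hi j hj => ?_⟩
  simp only [Finset.mem_filter, Finset.mem_univ, true_and] at hi hj
  have hdot (k l : ι) : (⇑(hH.eigenvectorBasis k) : ι → ℝ) ⬝ᵥ
      Q.mulVec ⇑(hH.eigenvectorBasis l) = if k = l then hH.eigenvalues l else 0 := by
    rw [hH.mulVec_eigenvectorBasis, dotProduct_smul]
    have h := orthonormal_iff_ite.1 hH.eigenvectorBasis.orthonormal l k
    rw [EuclideanSpace.inner_eq_star_dotProduct, star_trivial] at h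
    rw [h]
    simp [eq_comm]
  by_contra hij
  have hne {k : ι} (hk : hH.eigenvalues k < 0) : φ ⇑(hH.eigenvectorBasis k) ≠ 0 := fun h => by
    have := hφ _ h
    rw [hdot, if_pos rfl] at this
    linarith
  have hw := hφ (φ ⇑(hH.eigenvectorBasis j) • ⇑(hH.eigenvectorBasis i) +
    (-φ ⇑(hH.eigenvectorBasis i)) • ⇑(hH.eigenvectorBasis j)) (by simp; ring)
  rw [quad_smul_add_smul hQ, hdot, hdot, hdot, if_pos rfl, if_pos rfl, if_neg hij] at hw
  have h1 := mul_neg_of_pos_of_neg (pow_pos (abs_pos.2 (hne hj)) 2) hi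
  have h2 := mul_neg_of_pos_of_neg (pow_pos (abs_pos.2 (hne hi)) 2) hj
  rw [sq_abs] at h1 h2
  nlinarith

/-- A convex set that contains `0` and misses the open negative orthant lies in the half-space
of a nonzero nonnegative weight vector. -/
lemma exists_nonneg_weights {κ : Type*} [Fintype κ] [Nonempty κ] {C : Set (κ → ℝ)}
    (hC : Convex ℝ C) (h0 : (0 : κ → ℝ) ∈ C) (hneg : ∀ v ∈ C, ∃ i, 0 ≤ v i) :
    ∃ lam : κ → ℝ, 0 ≤ lam ∧ lam ≠ 0 ∧ ∀ v ∈ C, 0 ≤ ∑ i, lam i * v i := by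
  classical
  let N : Set (κ → ℝ) := Set.univ.pi fun _ => Set.Iio 0
  have hmem {v : κ → ℝ} : v ∈ N ↔ ∀ i, v i < 0 := by simp [N]
  obtain ⟨f, r, hN, hfC⟩ := geometric_hahn_banach_open (s := N) (t := C)
    (convex_pi fun _ _ => convex_Iio 0) (isOpen_set_pi Set.finite_univ fun _ _ => isOpen_Iio) hC
    (Set.disjoint_left.2 fun v hv hvC => by
      obtain ⟨i, hi⟩ := hneg v hvC
      exact absurd (hmem.1 hv i) hi.not_gt)
  have hr : r ≤ 0 := by simpa using hfC 0 h0
  have hNr (v : κ → ℝ) (hv : ∀ i, v i ≤ 0) : f v ≤ r := by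
    have hlim : Filter.Tendsto (fun ε : ℝ => f (v - ε • (1 : κ → ℝ)))
        (nhdsWithin 0 (Set.Ioi 0)) (nhds (f v)) := by
      have hc : Continuous fun ε : ℝ => f (v - ε • (1 : κ → ℝ)) := by fun_prop
      simpa using (hc.tendsto 0).mono_left nhdsWithin_le_nhds
    refine le_of_tendsto hlim (Filter.eventually_of_mem self_mem_nhdsWithin fun ε hε => ?_)
    refine (hN _ (hmem.2 fun i => ?_)).le
    have : (0 : ℝ) < ε := hε
    have := hv i
    simp
    linarith
  have hr0 : r = 0 := le_antisymm hr (by simpa using hNr 0 (by simp))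
  have hf (v : κ → ℝ) : f v = ∑ i, f (Pi.single i 1) * v i := by
    conv_lhs => rw [pi_eq_sum_univ' v, map_sum]
    refine Finset.sum_congr rfl fun i _ => ?_
    rw [map_smul, smul_eq_mul, mul_comm]
  refine ⟨fun i => f (Pi.single i 1), fun i => ?_, fun h => ?_, fun v hv => ?_⟩
  · have h := hNr (-Pi.single i 1) fun j => by
      by_cases hj : j = i <;> simp [hj]
    rw [map_neg, hr0] at h
    simpa using h
  · have h1 := hN (-1) (hmem.2 fun i => by simp)
    rw [hf] at h1
    simp only [fun i => congrFun h i] at h1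
    simp [hr0] at h1
  · rw [← hf, ← hr0]
    exact hfC v hv

lemma eventually_quadratic_neg {a b c : ℝ} (ha : a < 0) :
    ∀ᶠ s : ℝ in Filter.atTop, a * s ^ 2 + b * s + c < 0 := by
  filter_upwards [Filter.eventually_ge_atTop 1,
    Filter.eventually_gt_atTop ((|b| + |c|) / (-a))] with s h1 h2
  rw [div_lt_iff₀ (by linarith)] at h2
  nlinarith [le_abs_self b, le_abs_self c, abs_nonneg b, abs_nonneg c,
    mul_le_mul_of_nonneg_right (le_abs_self b) (by linarith : (0 : ℝ) ≤ s),
    mul_le_mul_of_nonneg_left h1 (abs_nonneg c)]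

lemma qmat_isSymm {n : ℕ} {A : Matrix (Fin n) (Fin n) ℝ} (hA : A.IsSymm) (b : Fin n → ℝ)
    (c : ℝ) : (Qmat A b c).IsSymm :=
  Matrix.IsSymm.fromBlocks hA rfl rfl

lemma qmat_quad {n : ℕ} (A : Matrix (Fin n) (Fin n) ℝ) (b : Fin n → ℝ) (c : ℝ)
    (x : Fin n → ℝ) (t : ℝ) :
    Sum.elim x (fun _ => t) ⬝ᵥ (Qmat A b c).mulVec (Sum.elim x fun _ : Unit => t) =
      x ⬝ᵥ A.mulVec x + 2 * t * (b ⬝ᵥ x) + c * t ^ 2 := by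
  rw [Qmat, Matrix.fromBlocks_mulVec, sumElim_dotProduct_sumElim]
  have h1 : (Matrix.of fun (i : Fin n) (_ : Unit) => b i).mulVec (fun _ => t) = t • b := by
    ext i
    simp [Matrix.mulVec, dotProduct, mul_comm]
  have h2 : (Matrix.of fun (_ : Unit) (j : Fin n) => b j).mulVec x = fun _ => b ⬝ᵥ x := by
    ext i
    simp [Matrix.mulVec, dotProduct]
  simp only [Sum.elim_comp_inl, Sum.elim_comp_inr, h1, h2, dotProduct_add, dotProduct_smul,
    dotProduct_comm x b]
  simp [Matrix.mulVec, dotProduct]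
  ring

lemma qmat_quad_one {n : ℕ} (A : Matrix (Fin n) (Fin n) ℝ) (b : Fin n → ℝ) (c : ℝ)
    (x : Fin n → ℝ) :
    Sum.elim x (fun _ => 1) ⬝ᵥ (Qmat A b c).mulVec (Sum.elim x fun _ : Unit => 1) =
      qf A b c x := by
  rw [qmat_quad, qf]
  ring

lemma qmat_quad_eq_sq_mul {n : ℕ} (A : Matrix (Fin n) (Fin n) ℝ) (b : Fin n → ℝ) (c : ℝ)
    (x : Fin n → ℝ) {t : ℝ} (ht : t ≠ 0) :
    Sum.elim x (fun _ => t) ⬝ᵥ (Qmat A b c).mulVec (Sum.elim x fun _ : Unit => t) =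
      t ^ 2 * qf A b c (t⁻¹ • x) := by
  rw [qmat_quad, qf]
  simp only [Matrix.mulVec_smul, smul_dotProduct, dotProduct_smul, smul_eq_mul]
  field_simp

lemma quad_sum_smul {ι κ : Type*} [Fintype ι] [Fintype κ] (Q : κ → Matrix ι ι ℝ) (lam : κ → ℝ)
    (v : ι → ℝ) :
    v ⬝ᵥ (∑ i, lam i • Q i).mulVec v = ∑ i, lam i * (v ⬝ᵥ (Q i).mulVec v) := by
  simp [Matrix.sum_mulVec, dotProduct_sum, Matrix.smul_mulVec]

lemma isOpen_sset {n m : ℕ} (A : Fin m → Matrix (Fin n) (Fin n) ℝ) (b : Fin m → Fin n → ℝ)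
    (c : Fin m → ℝ) : IsOpen (Sset A b c) := by
  simp only [Sset, Set.ofPred_forall]
  refine isOpen_iInter_of_finite fun i => isOpen_lt ?_ continuous_const
  unfold qf
  exact ((continuous_id.dotProduct (continuous_const.matrix_mulVec continuous_id)).add
    (continuous_const.mul (continuous_const.dotProduct continuous_id))).add continuous_const

/-- A common direction of negative curvature forces `conv S` to be the whole space. -/
lemma convexHull_sset_eq_univ {n m : ℕ} {A : Fin m → Matrix (Fin n) (Fin n) ℝ}
    (hA : ∀ i, (A i).IsSymm) (b : Fin m → Fin n → ℝ) (c : Fin m → ℝ)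
    {x : Fin n → ℝ} (hx : ∀ i, x ⬝ᵥ (A i).mulVec x < 0) :
    convexHull ℝ (Sset A b c) = Set.univ := by
  refine Set.eq_univ_of_forall fun z => ?_
  have hexp (y : Fin n → ℝ) (i : Fin m) (s : ℝ) : qf (A i) (b i) (c i) (z + s • y) =
      (y ⬝ᵥ (A i).mulVec y) * s ^ 2 + (2 * (z ⬝ᵥ (A i).mulVec y) + 2 * (b i ⬝ᵥ y)) * s +
        qf (A i) (b i) (c i) z := by
    have h := quad_smul_add_smul (hA i) z y 1 s
    rw [one_smul] at h
    rw [qf, qf, h, dotProduct_add, dotProduct_smul, smul_eq_mul]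
    ring
  have hev (y : Fin n → ℝ) (hy : ∀ i, y ⬝ᵥ (A i).mulVec y < 0) :
      ∀ᶠ s : ℝ in Filter.atTop, z + s • y ∈ Sset A b c := by
    simp only [Sset, Set.mem_ofPred_eq, Filter.eventually_all, hexp]
    exact fun i => eventually_quadratic_neg (hy i)
  obtain ⟨s, h1, h2⟩ := ((hev x hx).and (hev (-x) fun i => by
    simpa [Matrix.mulVec_neg] using hx i)).exists
  have h := (convex_convexHull ℝ (Sset A b c)) (subset_convexHull ℝ _ h1)
    (subset_convexHull ℝ _ h2) (by norm_num : (0 : ℝ) ≤ 1 / 2) (by norm_num : (0 : ℝ) ≤ 1 / 2)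
    (by norm_num)
  convert h using 1
  module

/-- If the functional `φ` is negative on the lift of `S` to height one and `conv S` is not
everything, then some nonnegative aggregation of the homogenized forms is nonnegative on the
hyperplane `φ = 0`. -/
lemma exists_aggregation_nonneg_on_ker {n m : ℕ} {A : Fin m → Matrix (Fin n) (Fin n) ℝ}
    {b : Fin m → Fin n → ℝ} {c : Fin m → ℝ} (hA : ∀ i, (A i).IsSymm)
    (hHHC : HHC fun i => Qmat (A i) (b i) (c i))
    (hconv : convexHull ℝ (Sset A b c) ≠ Set.univ)
    {φ : (Fin n ⊕ Unit → ℝ) →ₗ[ℝ] ℝ} (hφ0 : φ ≠ 0)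
    (hφ : ∀ x ∈ Sset A b c, φ (Sum.elim x fun _ => 1) < 0) :
    ∃ lam : Fin m → ℝ, 0 ≤ lam ∧ lam ≠ 0 ∧ ∀ w, φ w = 0 →
      0 ≤ w ⬝ᵥ (∑ i, lam i • Qmat (A i) (b i) (c i)).mulVec w := by
  have : Nonempty (Fin m) := by
    by_contra h
    rw [not_nonempty_iff] at h
    refine hconv ?_
    rw [show Sset A b c = Set.univ from Set.eq_univ_of_forall fun x i => h.elim i,
      convexHull_univ]
  obtain ⟨lam, h0, hne, hlam⟩ := exists_nonneg_weights (hHHC _ ⟨φ, hφ0, rfl⟩)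
    ⟨0, Submodule.zero_mem _, by ext; simp⟩ (by
      rintro _ ⟨w, hw, rfl⟩
      have hw : φ w = 0 := hw
      by_contra! hneg
      obtain ⟨x, t, rfl⟩ : ∃ (x : Fin n → ℝ) (t : ℝ), w = Sum.elim x fun _ => t :=
        ⟨w ∘ Sum.inl, w (Sum.inr ()), by ext (i | i) <;> rfl⟩
      by_cases ht : t = 0
      · subst ht
        exact hconv (convexHull_sset_eq_univ hA b c fun i => by simpa [qmat_quad] using hneg i)
      · have hx : t⁻¹ • x ∈ Sset A b c := fun i => by
          have h := hneg i
          rw [qmat_quad_eq_sq_mul _ _ _ _ ht] at h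
          exact (pos_iff_neg_of_mul_neg h).1 (by positivity)
        have h := hφ _ hx
        have hs : (Sum.elim (t⁻¹ • x) fun _ => 1 : Fin n ⊕ Unit → ℝ) =
            t⁻¹ • Sum.elim x fun _ => t := by
          ext (i | i) <;> simp [ht]
        rw [hs, map_smul, hw, smul_zero] at h
        exact h.false)
  refine ⟨lam, h0, hne, fun w hw => ?_⟩
  rw [quad_sum_smul]
  exact hlam _ ⟨w, hw, rfl⟩

/-- If the homogeneous quadratic map satisfies hidden hyperplane convexity, `S ≠ ∅` and
`conv(S) ≠ ℝⁿ`, then `conv(S)` is the intersection of all good aggregations. -/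
theorem statement0 (n m : ℕ) (hn : 3 ≤ n)
    (A : Fin m → Matrix (Fin n) (Fin n) ℝ) (b : Fin m → Fin n → ℝ) (c : Fin m → ℝ)
    (hsymm : ∀ i, (A i).IsSymm)
    (hHHC : HHC fun i => Qmat (A i) (b i) (c i))
    (hS : (Sset A b c).Nonempty)
    (hconv : convexHull ℝ (Sset A b c) ≠ Set.univ) :
    convexHull ℝ (Sset A b c) = ⋂ lam ∈ Omega A b c, Sagg A b c lam := by
  refine Set.Subset.antisymm (Set.subset_iInter₂ fun lam hlam => hlam.2.2.1) fun y hy => ?_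
  by_contra hyS
  obtain ⟨f, hf⟩ := geometric_hahn_banach_open_point (convex_convexHull ℝ (Sset A b c))
    (isOpen_sset A b c).convexHull hyS
  let φ : (Fin n ⊕ Unit → ℝ) →ₗ[ℝ] ℝ :=
    f.toLinearMap ∘ₗ LinearMap.funLeft ℝ ℝ Sum.inl - f y • LinearMap.proj (Sum.inr ())
  have hφ (x : Fin n → ℝ) : φ (Sum.elim x fun _ => 1) = f x - f y := by
    simp only [φ, LinearMap.sub_apply, LinearMap.comp_apply, LinearMap.smul_apply,
      LinearMap.proj_apply, Sum.elim_inr, smul_eq_mul, mul_one]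
    rfl
  have hφS (x : Fin n → ℝ) (hx : x ∈ Sset A b c) : φ (Sum.elim x fun _ => 1) < 0 := by
    rw [hφ]
    exact sub_neg.2 (hf x (subset_convexHull ℝ _ hx))
  have hφ0 : φ ≠ 0 := by
    obtain ⟨x, hx⟩ := hS
    intro h
    simpa [h] using hφS x hx
  obtain ⟨lam, h0, hne, hlam⟩ := exists_aggregation_nonneg_on_ker hsymm hHHC hconv hφ0 hφS
  have hQ : (∑ i, lam i • Qmat (A i) (b i) (c i)).IsSymm := by
    rw [Matrix.IsSymm, Matrix.transpose_sum]
    exact Finset.sum_congr rfl fun i _ => ((qmat_isSymm (hsymm i) _ _).smul _).eq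
  have hagg (x : Fin n → ℝ) : x ∈ Sagg A b c lam ↔ Sum.elim x (fun _ => 1) ⬝ᵥ
      (∑ i, lam i • Qmat (A i) (b i) (c i)).mulVec (Sum.elim x fun _ : Unit => 1) < 0 := by
    simp only [quad_sum_smul, qmat_quad_one, Sagg, Set.mem_ofPred_eq]
  have hsub : convexHull ℝ (Sset A b c) ⊆ {x | x ∈ Sagg A b c lam ∧ f x < f y} := by
    refine convexHull_min (fun x hx => ⟨?_, hf x (subset_convexHull ℝ _ hx)⟩) ?_
    · obtain ⟨j, hj⟩ := Function.ne_iff.1 hne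
      refine Finset.sum_neg' (fun i _ => mul_nonpos_of_nonneg_of_nonpos (h0 i) (hx i).le)
        ⟨j, Finset.mem_univ j, mul_neg_of_pos_of_neg ((h0 j).lt_of_ne' hj) (hx j)⟩
    · rintro u ⟨hu, hfu⟩ v ⟨hv, hfv⟩ s t hs ht hst
      refine ⟨?_, convex_halfSpace_lt f.toLinearMap.isLinear (f y) hfu hfv hs ht hst⟩
      rw [hagg] at hu hv ⊢
      have h := quad_neg_of_nonneg_on_ker hQ φ hlam (by rw [hφ]; linarith)
        (by rw [hφ]; linarith) hu hv hs ht hst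
      have he : (Sum.elim (s • u + t • v) fun _ => 1 : Fin n ⊕ Unit → ℝ) =
          s • (Sum.elim u fun _ => 1) + t • Sum.elim v fun _ => 1 := by
        ext (i | i) <;> simp [hst]
      rwa [he]
  have hΩ : lam ∈ Omega A b c :=
    ⟨h0, hne, fun x hx => (hsub hx).1, negEigsAtMostOne_of_nonneg_on_ker hQ φ hlam⟩
  exact ((hagg y).1 (Set.mem_iInter₂.1 hy lam hΩ)).not_ge (hlam _ (by rw [hφ, sub_self]))

end
end

section
/- Let f_1,…,f_m be quadratic functions f_i(x) = xᵀA_ix + 2b_iᵀx + c_i on ℝⁿ, let T = {x ∈ ℝⁿ : f_i(x) ≤ 0 for all i ∈ [m]} and G = int(closure(conv(T))). Assume the matrices Q_1,…,Q_m satisfy hidden hyperplane convexity, ∅ ⊊ G ⊊ ℝⁿ, and Q_λ ≠ 0 for every nonzero λ ≥ 0. Then G = ⋂_{λ∈Ω_T} S_λ, where Ω_T is the set of nonzero λ ≥ 0 such that Q_λ has at most one negative eigenvalue and G ⊆ S_λ. -/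
open Matrix Set

noncomputable section

/-- The set `T` defined by the closed quadratic inequalities. -/
def Tset {n m : ℕ} (A : Fin m → Matrix (Fin n) (Fin n) ℝ) (b : Fin m → Fin n → ℝ)
    (c : Fin m → ℝ) : Set (Fin n → ℝ) :=
  {x | ∀ i, qf (A i) (b i) (c i) x ≤ 0}

section QuadraticForms

variable {ι : Type*} [Fintype ι]

theorem sum_mul_quadForm {κ : Type*} [Fintype κ] (Q : κ → Matrix ι ι ℝ) (l : κ → ℝ)
    (z : ι → ℝ) :
    ∑ i, l i * (z ⬝ᵥ (Q i).mulVec z) = z ⬝ᵥ (∑ i, l i • Q i).mulVec z := by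
  simp [Matrix.sum_mulVec, dotProduct_sum, Matrix.smul_mulVec]

theorem quadForm_smul_add_smul {M : Matrix ι ι ℝ} (hM : M.IsSymm) (u v : ι → ℝ) (r s : ℝ) :
    (r • u + s • v) ⬝ᵥ M.mulVec (r • u + s • v) =
      r ^ 2 * (u ⬝ᵥ M.mulVec u) + 2 * r * s * (u ⬝ᵥ M.mulVec v) +
        s ^ 2 * (v ⬝ᵥ M.mulVec v) := by
  have h : v ⬝ᵥ M.mulVec u = u ⬝ᵥ M.mulVec v := by
    rw [dotProduct_mulVec, ← mulVec_transpose, hM.eq, dotProduct_comm]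
  simp only [mulVec_add, mulVec_smul, add_dotProduct, dotProduct_add, smul_dotProduct,
    dotProduct_smul, smul_eq_mul, h]
  ring

/-- A symmetric matrix whose quadratic form vanishes is zero. -/
theorem eq_zero_of_quadForm_eq_zero [DecidableEq ι] {M : Matrix ι ι ℝ} (hM : M.IsSymm)
    (h : ∀ z : ι → ℝ, z ⬝ᵥ M.mulVec z = 0) : M = 0 := by
  ext i j
  have h1 := quadForm_smul_add_smul hM (Pi.single i 1) (Pi.single j 1) 1 1
  rw [h, h, h] at h1
  simpa using h1

/-- A quadratic form that is nonnegative on a hyperplane is nonpositive on the cone generated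
by two points of its nonpositivity set lying strictly on the same side of the hyperplane. -/
theorem quadForm_nonpos_of_same_side {M : Matrix ι ι ℝ} (hM : M.IsSymm) {a : ι → ℝ}
    (ha : ∀ z, a ⬝ᵥ z = 0 → 0 ≤ z ⬝ᵥ M.mulVec z) {u v : ι → ℝ}
    (hu : u ⬝ᵥ M.mulVec u ≤ 0) (hv : v ⬝ᵥ M.mulVec v ≤ 0)
    (hau : a ⬝ᵥ u < 0) (hav : a ⬝ᵥ v < 0) {r s : ℝ} (hr : 0 ≤ r) (hs : 0 ≤ s) :
    (r • u + s • v) ⬝ᵥ M.mulVec (r • u + s • v) ≤ 0 := by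
  have h := ha ((a ⬝ᵥ v) • u + (-(a ⬝ᵥ u)) • v) (by
    simp only [dotProduct_add, dotProduct_smul, smul_eq_mul]; ring)
  rw [quadForm_smul_add_smul hM] at h ⊢
  have hpos : 0 < (a ⬝ᵥ u) * (a ⬝ᵥ v) := mul_pos_of_neg_of_neg hau hav
  have hB : u ⬝ᵥ M.mulVec v ≤ 0 := by
    by_contra! hB
    nlinarith [mul_pos hpos hB, mul_nonneg (sq_nonneg (a ⬝ᵥ v)) (neg_nonneg.2 hu),
      mul_nonneg (sq_nonneg (a ⬝ᵥ u)) (neg_nonneg.2 hv)]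
  nlinarith [mul_nonneg (mul_nonneg hr hs) (neg_nonneg.2 hB),
    mul_nonneg (sq_nonneg r) (neg_nonneg.2 hu), mul_nonneg (sq_nonneg s) (neg_nonneg.2 hv)]

/-- A quadratic form that is nonnegative on a hyperplane has at most one negative eigenvalue. -/
theorem negEigsAtMostOne_of_nonneg_on_hyperplane [DecidableEq ι] {M : Matrix ι ι ℝ}
    (hM : M.IsSymm) {a : ι → ℝ} (ha : ∀ z, a ⬝ᵥ z = 0 → 0 ≤ z ⬝ᵥ M.mulVec z) :
    NegEigsAtMostOne M := by
  have hH : M.IsHermitian := by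
    rw [Matrix.IsHermitian, conjTranspose_eq_transpose_of_trivial]; exact hM
  refine ⟨hH, Finset.card_le_one.2 fun i hi j hj => ?_⟩
  simp only [Finset.mem_filter, Finset.mem_univ, true_and] at hi hj
  by_contra hij
  set e : ι → ι → ℝ := fun k => (hH.eigenvectorBasis k : ι → ℝ) with he
  have hmul (k : ι) : M.mulVec (e k) = hH.eigenvalues k • e k := hH.mulVec_eigenvectorBasis k
  have hdot (k l : ι) : e k ⬝ᵥ e l = if k = l then 1 else 0 := by
    have h := orthonormal_iff_ite.1 hH.eigenvectorBasis.orthonormal l k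
    rw [EuclideanSpace.inner_eq_star_dotProduct] at h
    simpa [he, eq_comm] using h
  have hq (k : ι) : e k ⬝ᵥ M.mulVec (e k) = hH.eigenvalues k := by
    simp [hmul, hdot]
  have hB : e i ⬝ᵥ M.mulVec (e j) = 0 := by simp [hmul, hdot, hij]
  have h := ha ((a ⬝ᵥ e j) • e i + (-(a ⬝ᵥ e i)) • e j) (by
    simp only [dotProduct_add, dotProduct_smul, smul_eq_mul]; ring)
  rw [quadForm_smul_add_smul hM, hq, hq, hB] at h
  have hi0 : a ⬝ᵥ e i ≠ 0 := fun h0 => by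
    have := ha _ h0
    rw [hq] at this
    linarith
  nlinarith [mul_pos (pow_pos (abs_pos.2 hi0) 2) (neg_pos.2 hj), sq_abs (a ⬝ᵥ e i),
    mul_nonneg (sq_nonneg (a ⬝ᵥ e j)) (neg_pos.2 hi).le]

theorem strongDual_apply_eq_dotProduct [DecidableEq ι] (f : StrongDual ℝ (ι → ℝ)) (w : ι → ℝ) :
    f w = (fun i => f (Pi.single i 1)) ⬝ᵥ w := by
  conv_lhs => rw [pi_eq_sum_univ' w]
  simp only [map_sum, map_smul, smul_eq_mul, dotProduct]
  refine Finset.sum_congr rfl fun i _ => ?_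
  rw [mul_comm]

/-- If a convex set containing the origin misses the open negative orthant, some nonzero
nonnegative functional is nonnegative on it; it can be normalised to the standard simplex. -/
theorem exists_stdSimplex_nonneg_of_convex {κ : Type*} [Fintype κ] {C : Set (κ → ℝ)}
    (hC : Convex ℝ C) (h0 : (0 : κ → ℝ) ∈ C) (hneg : ∀ w ∈ C, ¬ ∀ i, w i < 0) :
    ∃ l ∈ stdSimplex ℝ κ, ∀ w ∈ C, 0 ≤ l ⬝ᵥ w := by
  classical
  set N : Set (κ → ℝ) := Set.pi univ fun _ => Iio 0 with hN
  have hNo : IsOpen N := isOpen_set_pi finite_univ fun _ _ => isOpen_Iio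
  have hNc : Convex ℝ N := convex_pi fun _ _ => convex_Iio 0
  have hd : Disjoint N C := Set.disjoint_left.2 fun w hw hwC =>
    hneg w hwC fun i => hw i (mem_univ i)
  obtain ⟨f, u, hfN, hfC⟩ := geometric_hahn_banach_open hNc hNo hC hd
  have hu : u ≤ 0 := by simpa using hfC 0 h0
  set l : κ → ℝ := fun i => f (Pi.single i 1) with hl
  have hf (w : κ → ℝ) : f w = l ⬝ᵥ w := strongDual_apply_eq_dotProduct f w
  have hcl (w : κ → ℝ) (hw : ∀ i, w i ≤ 0) : f w ≤ u := by
    have hmem : w ∈ closure N := by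
      rw [hN, closure_pi_set]
      intro i _
      rw [closure_Iio]
      exact hw i
    exact closure_minimal (fun x hx => (hfN x hx).le) (isClosed_le f.continuous continuous_const)
      hmem
  have hu0 : u = 0 := le_antisymm hu (by simpa using hcl 0 fun _ => le_rfl)
  subst hu0
  have hl0 (i : κ) : 0 ≤ l i := by
    have := hcl (-Pi.single i 1) fun j => by
      by_cases h : j = i <;> simp [h]
    rw [map_neg] at this
    simpa [hl] using this
  have hsum : 0 < ∑ i, l i := by
    have := hfN (fun _ => -1) fun i _ => by simp
    rw [hf] at this
    simpa [dotProduct] using this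
  refine ⟨(∑ i, l i)⁻¹ • l, ⟨fun i => mul_nonneg (inv_nonneg.2 hsum.le) (hl0 i), ?_⟩,
    fun w hw => ?_⟩
  · simp [← Finset.mul_sum, hsum.ne']
  · rw [smul_dotProduct, ← hf]
    exact mul_nonneg (inv_nonneg.2 hsum.le) (hfC w hw)

end QuadraticForms

section Homogenization

variable {n : ℕ}

/-- The homogenization `(x, 1)` of a point `x`. -/
def homog (x : Fin n → ℝ) : Fin n ⊕ Unit → ℝ := Sum.elim x fun _ => 1

/-- The normal vector of the linear hyperplane over the affine hyperplane through `y` with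
normal vector `α`. -/
def homogNormal (α y : Fin n → ℝ) : Fin n ⊕ Unit → ℝ := Sum.elim α fun _ => -(α ⬝ᵥ y)

theorem qf_eq_quadForm (A : Matrix (Fin n) (Fin n) ℝ) (b : Fin n → ℝ) (c : ℝ)
    (x : Fin n → ℝ) : qf A b c x = homog x ⬝ᵥ (Qmat A b c).mulVec (homog x) := by
  have h1 : (Matrix.of fun (i : Fin n) (_ : Unit) => b i).mulVec (fun _ => (1 : ℝ)) = b := by
    ext i; simp [mulVec, dotProduct]
  have h2 : (Matrix.of fun (_ : Unit) (j : Fin n) => b j).mulVec x = fun _ => b ⬝ᵥ x := by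
    ext i; simp [mulVec, dotProduct]
  have h3 : (Matrix.of fun (_ : Unit) (_ : Unit) => c).mulVec (fun _ => (1 : ℝ)) =
      fun _ => c := by
    ext i; simp [mulVec, dotProduct]
  rw [homog, Qmat, fromBlocks_mulVec, Sum.elim_comp_inl, Sum.elim_comp_inr, h1, h2, h3,
    sumElim_dotProduct_sumElim, dotProduct_add, dotProduct_comm x b, qf]
  simp [dotProduct]
  ring

theorem homogNormal_dotProduct_homog (α y x : Fin n → ℝ) :
    homogNormal α y ⬝ᵥ homog x = α ⬝ᵥ x - α ⬝ᵥ y := by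
  rw [homogNormal, homog, sumElim_dotProduct_sumElim]
  simp [dotProduct, sub_eq_add_neg]

theorem homog_convexCombo (x y : Fin n → ℝ) {r s : ℝ} (h : r + s = 1) :
    homog (r • x + s • y) = r • homog x + s • homog y := by
  ext (i | i) <;> simp [homog, h]

theorem smul_homog_of_ne_zero (z : Fin n ⊕ Unit → ℝ) (hz : z (Sum.inr ()) ≠ 0) :
    z = z (Sum.inr ()) • homog ((z (Sum.inr ()))⁻¹ • (z ∘ Sum.inl)) := by
  ext (i | i) <;> simp [homog, hz]

theorem continuous_homog : Continuous (homog (n := n)) := by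
  refine continuous_pi fun i => ?_
  rcases i with i | i
  · exact continuous_apply i
  · exact continuous_const

theorem continuous_homogNormal :
    Continuous fun p : (Fin n → ℝ) × (Fin n → ℝ) => homogNormal p.1 p.2 := by
  refine continuous_pi fun i => ?_
  rcases i with i | i
  · simp only [homogNormal, Sum.elim_inl]; fun_prop
  · simp only [homogNormal, Sum.elim_inr]; fun_prop

theorem Qmat_isSymm {A : Matrix (Fin n) (Fin n) ℝ} (hA : A.IsSymm) (b : Fin n → ℝ) (c : ℝ) :
    (Qmat A b c).IsSymm := by
  refine Matrix.IsSymm.fromBlocks hA ?_ ?_ <;> rfl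

/-- If an affine hyperplane misses the solution set of the inequalities, the homogeneous strict
inequalities have no common solution on the linear hyperplane over it. -/
theorem not_forall_quadForm_neg_of_disjoint {m : ℕ} (A : Fin m → Matrix (Fin n) (Fin n) ℝ)
    (b : Fin m → Fin n → ℝ) (c : Fin m → ℝ) {α y : Fin n → ℝ}
    (hT : ∀ x ∈ Tset A b c, α ⬝ᵥ x < α ⬝ᵥ y) (z : Fin n ⊕ Unit → ℝ)
    (hz : homogNormal α y ⬝ᵥ z = 0) :
    ¬ ∀ i, z ⬝ᵥ (Qmat (A i) (b i) (c i)).mulVec z < 0 := by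
  have key (w : Fin n ⊕ Unit → ℝ) (hw : homogNormal α y ⬝ᵥ w = 0) (hw0 : w (Sum.inr ()) ≠ 0) :
      ¬ ∀ i, w ⬝ᵥ (Qmat (A i) (b i) (c i)).mulVec w < 0 := by
    intro h
    obtain ⟨t, x, ht, hx⟩ : ∃ (t : ℝ) (x : Fin n → ℝ), t ≠ 0 ∧ w = t • homog x :=
      ⟨_, _, hw0, smul_homog_of_ne_zero w hw0⟩
    subst hx
    rw [dotProduct_smul, smul_eq_mul, homogNormal_dotProduct_homog] at hw
    have hxy : α ⬝ᵥ x = α ⬝ᵥ y := by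
      have := (mul_eq_zero.1 hw).resolve_left ht
      linarith
    refine (hT x fun i => ?_).ne hxy
    have hi := h i
    rw [mulVec_smul, smul_dotProduct, dotProduct_smul, smul_eq_mul, smul_eq_mul,
      ← qf_eq_quadForm, ← mul_assoc] at hi
    have htt := mul_self_pos.2 ht
    by_contra! hpos
    exact (mul_pos htt hpos).not_gt hi
  by_cases hz0 : z (Sum.inr ()) = 0
  · intro h
    have hev : ∀ᶠ ε : ℝ in nhdsWithin 0 (Ioi 0), ∀ i, (z + ε • homog y) ⬝ᵥ
        (Qmat (A i) (b i) (c i)).mulVec (z + ε • homog y) < 0 := by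
      refine Filter.eventually_all.2 fun i => ?_
      have hc : Continuous fun ε : ℝ => (z + ε • homog y) ⬝ᵥ
        (Qmat (A i) (b i) (c i)).mulVec (z + ε • homog y) := by fun_prop
      refine nhdsWithin_le_nhds (hc.continuousAt.eventually_lt continuousAt_const ?_)
      simpa using h i
    obtain ⟨ε, hε, hε0⟩ := (hev.and self_mem_nhdsWithin).exists
    refine key _ ?_ ?_ hε
    · rw [dotProduct_add, hz, dotProduct_smul, homogNormal_dotProduct_homog]; simp
    · simpa [hz0, homog] using (ne_of_gt hε0)
  · exact key z hz hz0

/-- Under hidden hyperplane convexity, an affine hyperplane strictly on one side of the solution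
set yields an aggregation that is nonnegative on the linear hyperplane over it. -/
theorem exists_aggregation_of_disjoint {m : ℕ} {A : Fin m → Matrix (Fin n) (Fin n) ℝ}
    {b : Fin m → Fin n → ℝ} {c : Fin m → ℝ} (hHHC : HHC fun i => Qmat (A i) (b i) (c i))
    {α y : Fin n → ℝ} (hα : α ≠ 0) (hT : ∀ x ∈ Tset A b c, α ⬝ᵥ x < α ⬝ᵥ y) :
    ∃ l ∈ stdSimplex ℝ (Fin m), ∀ z, homogNormal α y ⬝ᵥ z = 0 →
      0 ≤ z ⬝ᵥ (∑ i, l i • Qmat (A i) (b i) (c i)).mulVec z := by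
  set φ : (Fin n ⊕ Unit → ℝ) →ₗ[ℝ] ℝ :=
    { toFun := fun z => homogNormal α y ⬝ᵥ z
      map_add' := fun u v => dotProduct_add _ _ _
      map_smul' := fun r u => dotProduct_smul _ _ _ } with hφ
  have hφ0 : φ ≠ 0 := by
    intro h
    apply hα
    ext i
    have := LinearMap.congr_fun h (Pi.single (Sum.inl i) 1)
    simpa [hφ, homogNormal] using this
  have hconv := hHHC _ ⟨φ, hφ0, rfl⟩
  obtain ⟨l, hl, hlw⟩ := exists_stdSimplex_nonneg_of_convex hconv
    ⟨0, (LinearMap.ker φ).zero_mem, by ext; simp⟩ (by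
      rintro _ ⟨z, hz, rfl⟩
      exact not_forall_quadForm_neg_of_disjoint A b c hT z hz)
  refine ⟨l, hl, fun z hz => ?_⟩
  have h := hlw _ ⟨z, hz, rfl⟩
  rw [← sum_mul_quadForm]
  exact h

end Homogenization

section Aggregation

variable {n m : ℕ} {A : Fin m → Matrix (Fin n) (Fin n) ℝ} {b : Fin m → Fin n → ℝ}
  {c : Fin m → ℝ}

theorem sum_mul_qf (l : Fin m → ℝ) (x : Fin n → ℝ) :
    ∑ i, l i * qf (A i) (b i) (c i) x =
      homog x ⬝ᵥ (∑ i, l i • Qmat (A i) (b i) (c i)).mulVec (homog x) := by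
  simp_rw [qf_eq_quadForm]
  exact sum_mul_quadForm _ _ _

theorem aggregation_isSymm (hsymm : ∀ i, (A i).IsSymm) (l : Fin m → ℝ) :
    (∑ i, l i • Qmat (A i) (b i) (c i)).IsSymm := by
  rw [Matrix.IsSymm, transpose_sum]
  exact Finset.sum_congr rfl fun i _ => ((Qmat_isSymm (hsymm i) (b i) (c i)).smul (l i)).eq

/-- An aggregation that is nonnegative on a hyperplane strictly separated from the solution set
is nonpositive on the closed convex hull of the solution set. -/
theorem aggregation_nonpos_on_closure_convexHull (hsymm : ∀ i, (A i).IsSymm) {l : Fin m → ℝ}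
    (hl : 0 ≤ l) {α y : Fin n → ℝ} (hT : ∀ x ∈ Tset A b c, α ⬝ᵥ x < α ⬝ᵥ y)
    (hH : ∀ z, homogNormal α y ⬝ᵥ z = 0 →
      0 ≤ z ⬝ᵥ (∑ i, l i • Qmat (A i) (b i) (c i)).mulVec z) {x : Fin n → ℝ}
    (hx : x ∈ closure (convexHull ℝ (Tset A b c))) :
    homog x ⬝ᵥ (∑ i, l i • Qmat (A i) (b i) (c i)).mulVec (homog x) ≤ 0 := by
  set M := ∑ i, l i • Qmat (A i) (b i) (c i)
  have hconv : Convex ℝ {x : Fin n → ℝ | homog x ⬝ᵥ M.mulVec (homog x) ≤ 0 ∧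
      homogNormal α y ⬝ᵥ homog x < 0} := by
    rintro u ⟨hu, hu'⟩ v ⟨hv, hv'⟩ r s hr hs hrs
    simp only [mem_ofPred_eq]
    rw [homog_convexCombo _ _ hrs]
    refine ⟨quadForm_nonpos_of_same_side (aggregation_isSymm hsymm l) hH hu hv hu' hv' hr hs, ?_⟩
    simp only [dotProduct_add, dotProduct_smul, smul_eq_mul]
    rcases hr.eq_or_lt with rfl | hr
    · obtain rfl : s = 1 := by linarith
      linarith
    · nlinarith [mul_pos hr (neg_pos.2 hu'), mul_nonneg hs (neg_pos.2 hv').le]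
  have hsub : Tset A b c ⊆ {x : Fin n → ℝ | homog x ⬝ᵥ M.mulVec (homog x) ≤ 0 ∧
      homogNormal α y ⬝ᵥ homog x < 0} := by
    intro u hu
    refine ⟨?_, ?_⟩
    · rw [← sum_mul_qf]
      exact Finset.sum_nonpos fun i _ => mul_nonpos_of_nonneg_of_nonpos (hl i) (hu i)
    · rw [homogNormal_dotProduct_homog]
      linarith [hT u hu]
  have hc : Continuous fun x : Fin n → ℝ => homog x ⬝ᵥ M.mulVec (homog x) := by
    have := continuous_homog (n := n)
    fun_prop
  exact closure_minimal (fun u hu => (convexHull_min hsub hconv hu).1)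
    (isClosed_le hc continuous_const) hx

/-- A nonzero quadratic form that is nonpositive near `homog g` within the affine slice, and
nonnegative on a hyperplane not containing `homog g`, is negative at `homog g`. -/
theorem quadForm_homog_neg {M : Matrix (Fin n ⊕ Unit) (Fin n ⊕ Unit) ℝ} (hM : M.IsSymm)
    (hM0 : M ≠ 0) {g : Fin n → ℝ}
    (hg : ∀ᶠ x in nhds g, homog x ⬝ᵥ M.mulVec (homog x) ≤ 0) {a : Fin n ⊕ Unit → ℝ}
    (hag : a ⬝ᵥ homog g ≠ 0) (ha : ∀ z, a ⬝ᵥ z = 0 → 0 ≤ z ⬝ᵥ M.mulVec z) :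
    homog g ⬝ᵥ M.mulVec (homog g) < 0 := by
  refine lt_of_le_of_ne hg.self_of_nhds fun h0 => hM0 ?_
  have hexp (v : Fin n → ℝ) (s : ℝ) : homog (g + s • v) =
      (1 : ℝ) • homog g + s • (Sum.elim v fun _ => 0 : Fin n ⊕ Unit → ℝ) := by
    ext (i | i) <;> simp [homog]
  have hdir (v : Fin n → ℝ) :
      homog g ⬝ᵥ M.mulVec (Sum.elim v fun _ => 0) = 0 ∧
        (Sum.elim v fun _ => 0) ⬝ᵥ M.mulVec (Sum.elim v fun _ => 0) ≤ 0 := by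
    set w : Fin n ⊕ Unit → ℝ := Sum.elim v fun _ => 0
    have hev : ∀ᶠ s : ℝ in nhds 0, 2 * s * (homog g ⬝ᵥ M.mulVec w) +
        s ^ 2 * (w ⬝ᵥ M.mulVec w) ≤ 0 := by
      have hc : Filter.Tendsto (fun s : ℝ => g + s • v) (nhds 0) (nhds g) := by
        have : Continuous fun s : ℝ => g + s • v := by fun_prop
        simpa using this.tendsto 0
      filter_upwards [hc.eventually hg] with s hs
      rw [hexp, quadForm_smul_add_smul hM, h0] at hs
      linarith
    obtain ⟨ε, hε, hball⟩ := Metric.eventually_nhds_iff.1 hev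
    have hs (s : ℝ) (h : |s| < ε) := hball (y := s) (by simpa using h)
    set p := homog g ⬝ᵥ M.mulVec w
    set q := w ⬝ᵥ M.mulVec w
    have hq : q ≤ 0 := by
      have h1 := hs (ε / 2) (by rw [abs_of_pos (by linarith)]; linarith)
      have h2 := hs (-(ε / 2)) (by rw [abs_neg, abs_of_pos (by linarith)]; linarith)
      by_contra! hq
      nlinarith [mul_pos (pow_pos hε 2) hq]
    refine ⟨?_, hq⟩
    have hlim : ∀ (p' : ℝ), (∀ s, 0 < s → s < ε → 2 * s * p' + s ^ 2 * q ≤ 0) → p' ≤ 0 := by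
      intro p' h
      have hten : Filter.Tendsto (fun s : ℝ => 2 * p' + s * q) (nhdsWithin 0 (Ioi 0))
          (nhds (2 * p')) := by
        have : Continuous fun s : ℝ => 2 * p' + s * q := by fun_prop
        simpa using (this.tendsto 0).mono_left nhdsWithin_le_nhds
      have := le_of_tendsto hten (b := 0) (by
        filter_upwards [Ioo_mem_nhdsGT hε] with s hs'
        have := h s hs'.1 hs'.2
        by_contra! hpos
        nlinarith [mul_pos hs'.1 hpos])
      linarith
    refine le_antisymm (hlim p fun s h1 h2 => hs s (by rwa [abs_of_pos h1])) ?_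
    have := hlim (-p) fun s h1 h2 => by
      have := hs (-s) (by rwa [abs_neg, abs_of_pos h1])
      linarith
    linarith
  have hker (z : Fin n ⊕ Unit → ℝ) : homog g ⬝ᵥ M.mulVec z = 0 := by
    have hz : z = (Sum.elim (z ∘ Sum.inl - z (Sum.inr ()) • g) fun _ => 0) +
        z (Sum.inr ()) • homog g := by
      ext (i | i) <;> simp [homog]
    rw [hz, mulVec_add, mulVec_smul, dotProduct_add, dotProduct_smul, h0, (hdir _).1]
    simp
  have htrans (z : Fin n ⊕ Unit → ℝ) (τ : ℝ) :
      (τ • homog g + (1 : ℝ) • z) ⬝ᵥ M.mulVec (τ • homog g + (1 : ℝ) • z) =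
        z ⬝ᵥ M.mulVec z := by
    rw [quadForm_smul_add_smul hM, h0, hker]
    ring
  refine eq_zero_of_quadForm_eq_zero hM fun z => le_antisymm ?_ ?_
  · rw [← htrans z (-z (Sum.inr ()))]
    have hz : (-z (Sum.inr ())) • homog g + (1 : ℝ) • z =
        Sum.elim (z ∘ Sum.inl - z (Sum.inr ()) • g) fun _ => 0 := by
      ext (i | i) <;> simp [homog]
      ring
    rw [hz]
    exact (hdir _).2
  · rw [← htrans z (-(a ⬝ᵥ z) / (a ⬝ᵥ homog g))]
    apply ha
    simp only [dotProduct_add, dotProduct_smul, smul_eq_mul]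
    field_simp
    ring

theorem exists_unit_normal_of_notMem_closed_convex {K : Set (Fin n → ℝ)} (hK : Convex ℝ K)
    (hKc : IsClosed K) (hKne : K.Nonempty) {y : Fin n → ℝ} (hy : y ∉ K) :
    ∃ α ∈ Metric.sphere (0 : Fin n → ℝ) 1, ∀ x ∈ K, α ⬝ᵥ x < α ⬝ᵥ y := by
  obtain ⟨f, u, hfK, hfy⟩ := geometric_hahn_banach_closed_point hK hKc hy
  set l : Fin n → ℝ := fun i => f (Pi.single i 1) with hl
  have hf (w : Fin n → ℝ) : f w = l ⬝ᵥ w := strongDual_apply_eq_dotProduct f w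
  have hlt (x) (hx : x ∈ K) : l ⬝ᵥ x < l ⬝ᵥ y := by
    rw [← hf, ← hf]
    exact (hfK x hx).trans hfy
  have hl0 : l ≠ 0 := by
    rintro h
    obtain ⟨x, hx⟩ := hKne
    simpa [h] using hlt x hx
  have hpos : 0 < ‖l‖⁻¹ := inv_pos.2 (norm_pos_iff.2 hl0)
  refine ⟨‖l‖⁻¹ • l, ?_, fun x hx => ?_⟩
  · rw [mem_sphere_zero_iff_norm, norm_smul, norm_inv, norm_norm,
      inv_mul_cancel₀ (norm_ne_zero_iff.2 hl0)]
  · rw [smul_dotProduct, smul_dotProduct]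
    exact mul_lt_mul_of_pos_left (hlt x hx) hpos

/-- For a point outside the interior of the closed convex hull of the solution set, there is a
supporting direction together with an aggregation that is nonpositive on that hull and
nonnegative on the corresponding linear hyperplane. -/
theorem exists_supporting_aggregation (hsymm : ∀ i, (A i).IsSymm)
    (hHHC : HHC fun i => Qmat (A i) (b i) (c i))
    (hne : (closure (convexHull ℝ (Tset A b c))).Nonempty)
    {y : Fin n → ℝ} (hy : y ∉ interior (closure (convexHull ℝ (Tset A b c)))) :
    ∃ α : Fin n → ℝ, α ≠ 0 ∧ ∃ l ∈ stdSimplex ℝ (Fin m),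
      (∀ x ∈ closure (convexHull ℝ (Tset A b c)), α ⬝ᵥ x ≤ α ⬝ᵥ y ∧
        homog x ⬝ᵥ (∑ i, l i • Qmat (A i) (b i) (c i)).mulVec (homog x) ≤ 0) ∧
      ∀ g ∈ closure (convexHull ℝ (Tset A b c)), α ⬝ᵥ g < α ⬝ᵥ y →
        ∀ z, homogNormal α y ⬝ᵥ z = 0 →
          0 ≤ z ⬝ᵥ (∑ i, l i • Qmat (A i) (b i) (c i)).mulVec z := by
  set K := closure (convexHull ℝ (Tset A b c)) with hK
  have hKconv : Convex ℝ K := (convex_convexHull ℝ _).closure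
  have hKcl : IsClosed K := isClosed_closure
  have hTK : Tset A b c ⊆ K := (subset_convexHull ℝ _).trans subset_closure
  rw [← mem_compl_iff, ← closure_compl, mem_closure_iff_seq_limit] at hy
  obtain ⟨Y, hYK, hY⟩ := hy
  have hex (k : ℕ) : ∃ p : (Fin n → ℝ) × (Fin m → ℝ),
      p ∈ Metric.sphere (0 : Fin n → ℝ) 1 ×ˢ stdSimplex ℝ (Fin m) ∧
      (∀ x ∈ K, p.1 ⬝ᵥ x < p.1 ⬝ᵥ Y k) ∧ (∀ z, homogNormal p.1 (Y k) ⬝ᵥ z = 0 →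
        0 ≤ z ⬝ᵥ (∑ i, p.2 i • Qmat (A i) (b i) (c i)).mulVec z) := by
    obtain ⟨α, hα, hαK⟩ := exists_unit_normal_of_notMem_closed_convex hKconv hKcl hne (hYK k)
    have hα0 : α ≠ 0 := Metric.ne_of_mem_sphere hα one_ne_zero
    obtain ⟨l, hl, hlz⟩ :=
      exists_aggregation_of_disjoint hHHC hα0 fun x hx => hαK x (hTK hx)
    exact ⟨(α, l), ⟨hα, hl⟩, hαK, hlz⟩
  choose p hp hpK hpz using hex
  obtain ⟨⟨α, l⟩, ⟨hα, hl⟩, ψ, hψ, hlim⟩ :=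
    ((isCompact_sphere (0 : Fin n → ℝ) 1).prod (isCompact_stdSimplex ℝ (Fin m))).tendsto_subseq hp
  have hlimY : Filter.Tendsto (fun k => (p (ψ k), Y (ψ k))) Filter.atTop (nhds ((α, l), y)) :=
    hlim.prodMk_nhds (hY.comp hψ.tendsto_atTop)
  have hlimit {F : ((Fin n → ℝ) × (Fin m → ℝ)) × (Fin n → ℝ) → ℝ} (hF : Continuous F)
      (h : ∀ k, 0 ≤ F (p k, Y k)) : 0 ≤ F ((α, l), y) :=
    ge_of_tendsto' ((hF.tendsto _).comp hlimY) fun k => h (ψ k)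
  refine ⟨α, Metric.ne_of_mem_sphere hα one_ne_zero, l, hl, fun x hx => ⟨?_, ?_⟩,
    fun g hg hgy z hz => ?_⟩
  · have := hlimit (F := fun q => q.1.1 ⬝ᵥ q.2 - q.1.1 ⬝ᵥ x) (by fun_prop)
      fun k => sub_nonneg.2 (hpK k x hx).le
    simpa using this
  · have := hlimit (F := fun q => -(homog x ⬝ᵥ
      (∑ i, q.1.2 i • Qmat (A i) (b i) (c i)).mulVec (homog x))) (by fun_prop)
      fun k => neg_nonneg.2 (aggregation_nonpos_on_closure_convexHull hsymm (hp k).2.1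
        (fun x hx => hpK k x (hTK hx)) (hpz k) hx)
    simpa using this
  · set e : ((Fin n → ℝ) × (Fin m → ℝ)) × (Fin n → ℝ) → Fin n ⊕ Unit → ℝ := fun q =>
      (homogNormal q.1.1 q.2 ⬝ᵥ homog g) • z - (homogNormal q.1.1 q.2 ⬝ᵥ z) • homog g with he
    have hec : Continuous e := by
      have : Continuous fun q : ((Fin n → ℝ) × (Fin m → ℝ)) × (Fin n → ℝ) =>
          homogNormal q.1.1 q.2 :=
        continuous_homogNormal.comp (by fun_prop : Continuous fun
          q : ((Fin n → ℝ) × (Fin m → ℝ)) × (Fin n → ℝ) => (q.1.1, q.2))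
      fun_prop
    have := hlimit (F := fun q => e q ⬝ᵥ
      (∑ i, q.1.2 i • Qmat (A i) (b i) (c i)).mulVec (e q)) (by fun_prop)
      fun k => hpz k _ (by
        simp only [he, dotProduct_sub, dotProduct_smul, smul_eq_mul]; ring)
    simp only [he, hz, zero_smul, sub_zero, mulVec_smul, dotProduct_smul, smul_dotProduct,
      smul_eq_mul, ← mul_assoc] at this
    refine nonneg_of_mul_nonneg_right this (mul_self_pos.2 ?_)
    rw [homogNormal_dotProduct_homog]
    exact (sub_neg.2 hgy).ne

end Aggregation

theorem dotProduct_lt_of_mem_interior {n : ℕ} {K : Set (Fin n → ℝ)} {α : Fin n → ℝ}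
    (hα : α ≠ 0) {β : ℝ} (hK : ∀ x ∈ K, α ⬝ᵥ x ≤ β) {g : Fin n → ℝ} (hg : g ∈ interior K) :
    α ⬝ᵥ g < β := by
  have hc : Filter.Tendsto (fun s : ℝ => g + s • α) (nhdsWithin 0 (Ioi 0)) (nhds g) := by
    have : Continuous fun s : ℝ => g + s • α := by fun_prop
    simpa using (this.tendsto 0).mono_left nhdsWithin_le_nhds
  obtain ⟨s, hs, hs0⟩ :=
    ((hc.eventually (mem_interior_iff_mem_nhds.1 hg)).and self_mem_nhdsWithin).exists
  have h := hK _ hs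
  rw [dotProduct_add, dotProduct_smul, smul_eq_mul] at h
  have hαα : 0 < α ⬝ᵥ α := by
    have := dotProduct_star_self_pos_iff.2 hα
    simpa using this
  linarith [mul_pos (mem_Ioi.1 hs0) hαα]

/-- Closed inequalities: under HHC and the non-degeneracy condition `Q_λ ≠ 0`, the interior
of the closure of `conv(T)` is the intersection of the good aggregations containing it. -/
theorem statement3 (n m : ℕ)
    (A : Fin m → Matrix (Fin n) (Fin n) ℝ) (b : Fin m → Fin n → ℝ) (c : Fin m → ℝ)
    (hsymm : ∀ i, (A i).IsSymm)
    (hHHC : HHC fun i => Qmat (A i) (b i) (c i))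
    (G : Set (Fin n → ℝ))
    (hG : G = interior (closure (convexHull ℝ (Tset A b c))))
    (hGne : G.Nonempty) (hGuniv : G ≠ Set.univ)
    (hQnz : ∀ lam : Fin m → ℝ, 0 ≤ lam → lam ≠ 0 →
      (∑ i, lam i • Qmat (A i) (b i) (c i)) ≠ 0) :
    G = ⋂ lam ∈ {lam : Fin m → ℝ | 0 ≤ lam ∧ lam ≠ 0 ∧
        NegEigsAtMostOne (∑ i, lam i • Qmat (A i) (b i) (c i)) ∧ G ⊆ Sagg A b c lam},
      Sagg A b c lam := by
  refine Subset.antisymm (fun x hx => ?_) fun y hy => ?_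
  · simp only [mem_iInter]
    exact fun lam hlam => hlam.2.2.2 hx
  · by_contra hyG
    have hGK : G ⊆ closure (convexHull ℝ (Tset A b c)) := hG ▸ interior_subset
    obtain ⟨α, hα, l, hl, hK, hH⟩ :=
      exists_supporting_aggregation hsymm hHHC (hGne.mono hGK) (hG ▸ hyG)
    have hlt (g) (hg : g ∈ G) : α ⬝ᵥ g < α ⬝ᵥ y :=
      dotProduct_lt_of_mem_interior hα (fun x hx => (hK x hx).1) (hG ▸ hg)
    obtain ⟨g₀, hg₀⟩ := hGne
    have hH' := hH g₀ (hGK hg₀) (hlt g₀ hg₀)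
    have hl0 : l ≠ 0 := by
      rintro rfl
      simpa using hl.2
    have hM := aggregation_isSymm (b := b) (c := c) hsymm l
    have hyl := mem_iInter₂.1 hy l ⟨hl.1, hl0,
      negEigsAtMostOne_of_nonneg_on_hyperplane hM hH', fun g hg => by
        have hnhds : G ∈ nhds g := (hG ▸ isOpen_interior : IsOpen G).mem_nhds hg
        rw [Sagg, mem_ofPred_eq, sum_mul_qf]
        refine quadForm_homog_neg hM (hQnz l hl.1 hl0) ?_ ?_ hH'
        · filter_upwards [hnhds] with x hx using (hK x (hGK hx)).2
        · rw [homogNormal_dotProduct_homog]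
          exact (sub_neg.2 (hlt g hg)).ne⟩
    rw [Sagg, mem_ofPred_eq, sum_mul_qf] at hyl
    exact hyl.not_ge (hH' _ (by rw [homogNormal_dotProduct_homog, sub_self]))

end
end

section
/- Fix integers n > m+1 with m ≥ 2. Let f_0,…,f_m : ℝⁿ → ℝ be quadratic forms such that f_0 is positive definite, and suppose there exists a linear form ℓ : ℝⁿ → ℝ such that for all 1 ≤ i ≤ m, f_i(x) = ℓ(x)ℓ_i(x) for some linear form ℓ_i : ℝⁿ → ℝ. Then the quadratic map φ = (f_0,…,f_m) : ℝⁿ → ℝ^{m+1} satisfies hidden hyperplane convexity. -/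
open Matrix Set

noncomputable section

/-- An increasing quadratic through a value at most `T` attains `T`. -/
lemma exists_quadratic_eq {A B C T : ℝ} (hA : 0 < A) (hT : C ≤ T) :
    ∃ c : ℝ, c ^ 2 * A + 2 * c * B + C = T := by
  have hD : 0 ≤ B ^ 2 + A * (T - C) :=
    add_nonneg (sq_nonneg B) (mul_nonneg hA.le (sub_nonneg.2 hT))
  refine ⟨(√(B ^ 2 + A * (T - C)) - B) / A, ?_⟩
  have h := Real.sq_sqrt hD
  field_simp
  linear_combination h

/-- The value `T` is attained by a form `c² A + 2 B + c⁻² C` that is at most `T` at `c = 1`. -/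
lemma exists_sq_add_inv_sq_eq {A B C T : ℝ} (hA : 0 < A) (hC : 0 ≤ C)
    (hT : A + 2 * B + C ≤ T) :
    ∃ c : ℝ, c ≠ 0 ∧ c ^ 2 * A + 2 * B + c⁻¹ ^ 2 * C = T := by
  set M : ℝ := 1 + |T - 2 * B| / A with hM
  have hM1 : 1 ≤ M := by
    have : 0 ≤ |T - 2 * B| / A := by positivity
    linarith
  have hMA : T - 2 * B ≤ M * A := by
    have : M * A = A + |T - 2 * B| := by rw [hM]; field_simp
    linarith [le_abs_self (T - 2 * B)]
  have hcont : ContinuousOn (fun c : ℝ => c ^ 2 * A + 2 * B + c⁻¹ ^ 2 * C) (Icc 1 M) := by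
    have hinv : ContinuousOn (fun c : ℝ => c⁻¹) (Icc 1 M) :=
      continuousOn_inv₀.mono fun c hc => (zero_lt_one.trans_le hc.1).ne'
    fun_prop
  have hmem : T ∈ Icc ((1 : ℝ) ^ 2 * A + 2 * B + (1 : ℝ)⁻¹ ^ 2 * C)
      (M ^ 2 * A + 2 * B + M⁻¹ ^ 2 * C) := by
    constructor
    · simpa using hT
    · have h1 : 0 ≤ M⁻¹ ^ 2 * C := by positivity
      have h2 : M * A ≤ M ^ 2 * A := by
        apply mul_le_mul_of_nonneg_right _ hA.le
        nlinarith
      linarith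
  obtain ⟨c, hc, hcT⟩ := intermediate_value_Icc hM1 hcont hmem
  exact ⟨c, (zero_lt_one.trans_le hc.1).ne', hcT⟩

section PositiveDefinite

variable {V W : Type*} [AddCommGroup V] [Module ℝ V] [AddCommGroup W] [Module ℝ W]

lemma bilin_self_smul_add_smul {b : LinearMap.BilinForm ℝ V} (hsymm : ∀ x y, b x y = b y x)
    (s t : ℝ) (x y : V) :
    b (s • x + t • y) (s • x + t • y) = s ^ 2 * b x x + 2 * (s * t) * b x y + t ^ 2 * b y y := by
  simp only [map_add, map_smul, LinearMap.add_apply, LinearMap.smul_apply, smul_eq_mul, hsymm y x]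
  ring

/-- If `b` is positive definite, `ℓ` is a linear form and the linear map `L` has a nontrivial
kernel, then every point of the segment between two values of `x ↦ (b x x, ℓ x • L x)` is again
a value. -/
lemma exists_bilin_self_eq_and_smul_eq {b : LinearMap.BilinForm ℝ V}
    (hsymm : ∀ x y, b x y = b y x) (hpos : ∀ x, x ≠ 0 → 0 < b x x)
    (ℓ : V →ₗ[ℝ] ℝ) (L : V →ₗ[ℝ] W) {v : V} (hv : v ≠ 0) (hLv : L v = 0)
    (x y : V) {s t : ℝ} (hs : 0 ≤ s) (ht : 0 ≤ t) (hst : s + t = 1) :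
    ∃ z, b z z = s * b x x + t * b y y ∧ ℓ z • L z = s • ℓ x • L x + t • ℓ y • L y := by
  have hnonneg : ∀ x, 0 ≤ b x x := fun x => by
    by_cases hx : x = 0
    · simp [hx]
    · exact (hpos x hx).le
  have hvv := hpos v hv
  set T := s * b x x + t * b y y with hT
  have hT0 : 0 ≤ T := add_nonneg (mul_nonneg hs (hnonneg x)) (mul_nonneg ht (hnonneg y))
  have hr0 : 0 ≤ s * ℓ x ^ 2 + t * ℓ y ^ 2 := by positivity
  rcases hr0.eq_or_lt with hr | hr
  · have hx : s * ℓ x = 0 := by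
      have : s * ℓ x ^ 2 = 0 := by
        linarith [mul_nonneg hs (sq_nonneg (ℓ x)), mul_nonneg ht (sq_nonneg (ℓ y))]
      simpa using this
    have hy : t * ℓ y = 0 := by
      have : t * ℓ y ^ 2 = 0 := by
        linarith [mul_nonneg hs (sq_nonneg (ℓ x)), mul_nonneg ht (sq_nonneg (ℓ y))]
      simpa using this
    obtain ⟨c, hc⟩ := exists_quadratic_eq (B := 0) hvv hT0
    refine ⟨c • v, ?_, ?_⟩
    · rw [← hc]
      simp only [map_smul, LinearMap.smul_apply, smul_eq_mul]
      ring
    · simp [hLv, smul_smul, hx, hy]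
  · set r := √(s * ℓ x ^ 2 + t * ℓ y ^ 2)
    have hrpos : 0 < r := Real.sqrt_pos.2 hr
    have hrsq : r ^ 2 = s * ℓ x ^ 2 + t * ℓ y ^ 2 := Real.sq_sqrt hr0
    obtain ⟨u, hu⟩ : ∃ u, u = (s * ℓ x) • x + (t * ℓ y) • y := ⟨_, rfl⟩
    obtain ⟨z, hz⟩ : ∃ z, z = r⁻¹ • u := ⟨_, rfl⟩
    have hℓz : ℓ z = r := by
      rw [hz, hu]
      simp only [map_smul, map_add, smul_eq_mul]
      field_simp
      rw [hrsq]
    have hLz : r • L z = s • ℓ x • L x + t • ℓ y • L y := by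
      rw [hz, map_smul, smul_inv_smul₀ hrpos.ne', hu]
      simp only [map_add, map_smul, smul_smul]
    have hzT : b z z ≤ T := by
      have h1 : b u u ≤ r ^ 2 * T := by
        have h2 : 0 ≤ s * t * b (ℓ y • x + (-ℓ x) • y) (ℓ y • x + (-ℓ x) • y) :=
          mul_nonneg (mul_nonneg hs ht) (hnonneg _)
        rw [bilin_self_smul_add_smul hsymm] at h2
        rw [hu, bilin_self_smul_add_smul hsymm, hrsq, hT]
        obtain rfl : t = 1 - s := by linarith
        linarith
      have h3 : b z z = b u u / r ^ 2 := by
        rw [hz]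
        simp only [map_smul, LinearMap.smul_apply, smul_eq_mul]
        field_simp
      rw [h3, div_le_iff₀ (by positivity)]
      linarith
    by_cases hℓv : ℓ v = 0
    · obtain ⟨c, hc⟩ := exists_quadratic_eq (B := b v z) hvv hzT
      refine ⟨c • v + (1 : ℝ) • z, ?_, ?_⟩
      · rw [bilin_self_smul_add_smul hsymm, ← hc]
        ring
      · simp [hLv, hℓv, hℓz, hLz]
    · obtain ⟨p, hp⟩ : ∃ p, p = (r / ℓ v) • v := ⟨_, rfl⟩
      have hp0 : p ≠ 0 := by
        rw [hp]
        exact smul_ne_zero (div_ne_zero hrpos.ne' hℓv) hv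
      have hℓp : ℓ p = r := by simp [hp, hℓv]
      have hLp : L p = 0 := by simp [hp, hLv]
      have hsum : b p p + 2 * b p (z - p) + b (z - p) (z - p) ≤ T := by
        have h := bilin_self_smul_add_smul hsymm 1 1 p (z - p)
        simp only [one_smul, add_sub_cancel] at h
        linarith
      obtain ⟨c, hc0, hc⟩ := exists_sq_add_inv_sq_eq (hpos p hp0) (hnonneg (z - p)) hsum
      refine ⟨c • p + c⁻¹ • (z - p), ?_, ?_⟩
      · rw [bilin_self_smul_add_smul hsymm, mul_inv_cancel₀ hc0, mul_one, hc]
      · rw [← hLz]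
        simp only [map_add, map_smul, map_sub, hℓp, hLp, hℓz, sub_self, sub_zero, smul_zero,
          zero_add, mul_zero, add_zero, smul_smul, smul_eq_mul]
        congr 1
        field_simp

end PositiveDefinite

/-- If `n > m+1`, `f₀` is positive definite, and each `fᵢ` (`1 ≤ i ≤ m`) factors as
`ℓ(x)·ℓᵢ(x)` for a common linear form `ℓ`, then `(f₀,…,f_m)` satisfies hidden
hyperplane convexity. -/
theorem statement4 (n m : ℕ) (hm : 2 ≤ m) (hn : m + 1 < n)
    (Q : Fin (m + 1) → Matrix (Fin n) (Fin n) ℝ) (hsymm : ∀ i, (Q i).IsSymm)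
    (hpd : ∀ x : Fin n → ℝ, x ≠ 0 → 0 < x ⬝ᵥ (Q 0).mulVec x)
    (ℓ : (Fin n → ℝ) →ₗ[ℝ] ℝ)
    (hfact : ∀ i : Fin m, ∃ ℓi : (Fin n → ℝ) →ₗ[ℝ] ℝ,
      ∀ x, x ⬝ᵥ (Q i.succ).mulVec x = ℓ x * ℓi x) :
    HHC Q := by
  rintro H ⟨φ, -, rfl⟩
  choose L hL using hfact
  obtain ⟨v, hvker, hv⟩ := (Submodule.ne_bot_iff _).1
    (LinearMap.ker_ne_bot_of_finrank_lt (f := φ.prod (LinearMap.pi L)) (by simp; omega))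
  have hφv : φ v = 0 := congrArg Prod.fst hvker
  have hLv : LinearMap.pi L v = 0 := congrArg Prod.snd hvker
  have hbil : ∀ x y, Matrix.toBilin' (Q 0) x y = x ⬝ᵥ (Q 0).mulVec y :=
    Matrix.toBilin'_apply' (Q 0)
  rintro _ ⟨x, hx, rfl⟩ _ ⟨y, hy, rfl⟩ s t hs ht hst
  obtain ⟨z, hz0, hz⟩ := exists_bilin_self_eq_and_smul_eq
    (b := (Matrix.toBilin' (Q 0)).restrict (LinearMap.ker φ))
    (fun x y => by
      simp only [LinearMap.BilinForm.restrict_apply, LinearMap.domRestrict_apply, hbil]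
      rw [Matrix.dotProduct_mulVec, ← Matrix.mulVec_transpose, (hsymm 0).eq, dotProduct_comm])
    (fun x hx => by
      simp only [LinearMap.BilinForm.restrict_apply, LinearMap.domRestrict_apply, hbil]
      exact hpd x (by simpa using hx))
    (ℓ.domRestrict (LinearMap.ker φ)) ((LinearMap.pi L).domRestrict (LinearMap.ker φ))
    (v := ⟨v, hφv⟩) (fun h => hv (congrArg Subtype.val h)) hLv ⟨x, hx⟩ ⟨y, hy⟩ hs ht hst
  refine ⟨z, z.2, funext fun k => ?_⟩
  refine Fin.cases ?_ (fun i => ?_) k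
  · simpa [hbil] using hz0
  · simpa [hL] using congrFun hz i

end
end

section
/- Let n ≥ 2, let f_i(x) = xᵀA_ix + 2b_iᵀx + c_i, i ∈ [m], be quadratic functions on ℝⁿ, and assume all the matrices Q_1,…,Q_m are diagonal. Let S = {x ∈ ℝⁿ : f_i(x) < 0 for all i ∈ [m]}. Then: (1) S = ∅ if and only if there exists a nonzero λ ≥ 0 such that Σᵢ λ_iQ_i is positive semidefinite; (2) if S ≠ ∅, then conv(S) ≠ ℝⁿ if and only if there exists λ ≥ 0 such that the leading n×n principal submatrix Σᵢ λ_iA_i of Σᵢ λ_iQ_i is nonzero and positive semidefinite; (3) if ∅ ⊊ conv(S) ⊊ ℝⁿ, then conv(S) equals the intersection of finitely many sets S_λ with λ ≥ 0 nonzero and Σᵢ λ_iA_i positive semidefinite. -/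
open Matrix Set

noncomputable section

theorem exists_finset_eliminate_var {ι : Type} [Fintype ι] (p : ι → ℝ) :
    ∃ M : Finset (ι → ℝ), (∀ μ ∈ M, 0 ≤ μ ∧ μ ≠ 0 ∧ 0 ≤ μ ⬝ᵥ p) ∧
      ∀ r : ι → ℝ, (∀ μ ∈ M, μ ⬝ᵥ r < 0) → ∃ t : ℝ, 0 ≤ t ∧ ∀ i, p i * t + r i < 0 := by
  classical
  refine ⟨(Finset.univ.filter fun i => 0 ≤ p i).image (fun i => Pi.single i 1) ∪
    (Finset.univ.filter fun q : ι × ι => 0 < p q.1 ∧ p q.2 < 0).image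
      (fun q => Pi.single q.1 (-p q.2) + Pi.single q.2 (p q.1)), ?_, ?_⟩
  · intro μ hμ
    simp only [Finset.mem_union, Finset.mem_image, Finset.mem_filter, Finset.mem_univ,
      true_and, Prod.exists] at hμ
    rcases hμ with ⟨i, hi, rfl⟩ | ⟨i, j, ⟨hi, hj⟩, rfl⟩
    · refine ⟨Pi.single_nonneg.2 zero_le_one, ?_, ?_⟩
      · simp
      · simpa using hi
    · have hi' : (0 : ι → ℝ) ≤ Pi.single i (-p j) := Pi.single_nonneg.2 (by linarith)
      have hj' : (0 : ι → ℝ) ≤ Pi.single j (p i) := Pi.single_nonneg.2 hi.le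
      refine ⟨add_nonneg hi' hj', fun h => ?_, ?_⟩
      · have h1 := congrFun h i
        have h2 : 0 ≤ (Pi.single j (p i) : ι → ℝ) i := hj' i
        simp only [Pi.add_apply, Pi.single_eq_same, Pi.zero_apply] at h1
        linarith
      · simp only [add_dotProduct, single_dotProduct]
        linarith [mul_comm (p i) (p j)]
  · intro r hr
    have hsingle (i : ι) (hi : 0 ≤ p i) : r i < 0 := by
      simpa using hr (Pi.single i 1) (Finset.mem_union_left _
        (Finset.mem_image_of_mem _ (by simpa using hi)))
    have hpair (i j : ι) (hi : 0 < p i) (hj : p j < 0) : -p j * r i + p i * r j < 0 := by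
      have h := hr (Pi.single i (-p j) + Pi.single j (p i)) (Finset.mem_union_right _
        (Finset.mem_image.2 ⟨(i, j), by simpa using ⟨hi, hj⟩, rfl⟩))
      rwa [add_dotProduct, single_dotProduct, single_dotProduct] at h
    obtain ⟨t, hlo, hhi⟩ := Order.exists_between_finsets
      (insert 0 ((Finset.univ.filter fun j => p j < 0).image fun j => r j / -p j))
      ((Finset.univ.filter fun i => 0 < p i).image fun i => -r i / p i) (by
        intro x hx y hy
        simp only [Finset.mem_insert, Finset.mem_image, Finset.mem_filter, Finset.mem_univ,
          true_and] at hx hy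
        obtain ⟨i, hi, rfl⟩ := hy
        rcases hx with rfl | ⟨j, hj, rfl⟩
        · exact div_pos (neg_pos.2 (hsingle i hi.le)) hi
        · rw [div_lt_div_iff₀ (neg_pos.2 hj) hi]
          linarith [hpair i j hi hj])
    refine ⟨t, (hlo 0 (Finset.mem_insert_self _ _)).le, fun i => ?_⟩
    rcases lt_trichotomy (p i) 0 with hi | hi | hi
    · have h := hlo (r i / -p i) (Finset.mem_insert_of_mem
        (Finset.mem_image_of_mem (fun j => r j / -p j) (by simpa using hi)))
      rw [div_lt_iff₀ (neg_pos.2 hi)] at h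
      linarith
    · simpa [hi] using hsingle i hi.ge
    · have h := hhi (-r i / p i)
        (Finset.mem_image_of_mem (fun i => -r i / p i) (by simpa using hi))
      rw [lt_div_iff₀ hi] at h
      linarith

theorem exists_finset_certificates (n : ℕ) {ι : Type} [Fintype ι] (a : Matrix ι (Fin n) ℝ) :
    ∃ Λ : Finset (ι → ℝ), (∀ l ∈ Λ, 0 ≤ l ∧ l ≠ 0 ∧ 0 ≤ l ᵥ* a) ∧
      ∀ d : ι → ℝ, (∀ l ∈ Λ, l ⬝ᵥ d < 0) → ∃ w : Fin n → ℝ, 0 ≤ w ∧ ∀ i, (a *ᵥ w) i + d i < 0 := by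
  classical
  induction n generalizing ι with
  | zero =>
    refine ⟨Finset.univ.image fun i => Pi.single i 1, ?_, fun d hd => ⟨0, le_rfl, fun i => ?_⟩⟩
    · intro l hl
      obtain ⟨i, -, rfl⟩ := Finset.mem_image.1 hl
      exact ⟨Pi.single_nonneg.2 zero_le_one, by simp, fun k => k.elim0⟩
    · simpa using hd (Pi.single i 1) (Finset.mem_image_of_mem _ (Finset.mem_univ i))
  | succ n ih =>
    obtain ⟨M, hM, hMr⟩ := exists_finset_eliminate_var fun i => a i 0
    let N : Matrix M ι ℝ := fun μ => μ.1
    let a' : Matrix ι (Fin n) ℝ := fun i k => a i k.succ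
    obtain ⟨Λ, hΛ, hΛd⟩ := ih (N * a')
    have hN (i : ι) : 0 ≤ fun μ => N μ i := fun μ => (hM μ.1 μ.2).1 i
    refine ⟨Λ.image fun l => l ᵥ* N, ?_, fun d hd => ?_⟩
    · intro l' hl'
      obtain ⟨l, hl, rfl⟩ := Finset.mem_image.1 hl'
      obtain ⟨hl0, hlne, hla⟩ := hΛ l hl
      refine ⟨fun i => dotProduct_nonneg_of_nonneg hl0 (hN i), fun h => hlne ?_, fun k => ?_⟩
      · funext μ
        obtain ⟨i, hi⟩ := Function.ne_iff.1 (hM μ.1 μ.2).2.1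
        have h1 : ∑ μ, l μ * N μ i = 0 := congrFun h i
        have h2 := (Finset.sum_eq_zero_iff_of_nonneg
          fun μ _ => mul_nonneg (hl0 μ) (hN i μ)).1 h1 μ (Finset.mem_univ _)
        exact (mul_eq_zero.1 h2).resolve_right hi
      · refine Fin.cases ?_ (fun k => ?_) k
        · change 0 ≤ (l ᵥ* N) ⬝ᵥ fun i => a i 0
          rw [← dotProduct_mulVec]
          exact dotProduct_nonneg_of_nonneg hl0 fun μ => (hM μ.1 μ.2).2.2
        · change 0 ≤ ((l ᵥ* N) ᵥ* a') k
          rw [vecMul_vecMul]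
          exact hla k
    · obtain ⟨w, hw0, hw⟩ := hΛd (N *ᵥ d) fun l hl => by
        rw [dotProduct_mulVec]
        exact hd _ (Finset.mem_image_of_mem _ hl)
      obtain ⟨t, ht0, ht⟩ := hMr (a' *ᵥ w + d) fun μ hμ => by
        have h := hw ⟨μ, hμ⟩
        rw [← mulVec_mulVec, ← Pi.add_apply, ← mulVec_add] at h
        exact h
      refine ⟨Fin.cons t w, fun k => Fin.cases ht0 hw0 k, fun i => ?_⟩
      have h := ht i
      simp only [Pi.add_apply, mulVec, dotProduct, Fin.sum_univ_succ, Fin.cons_zero, Fin.cons_succ,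
        a'] at h ⊢
      linarith

theorem dotProduct_neg_of_nonneg_of_neg {ι : Type} [Fintype ι] {l y : ι → ℝ} (hl : 0 ≤ l)
    (hl0 : l ≠ 0) (hy : ∀ i, y i < 0) : l ⬝ᵥ y < 0 := by
  obtain ⟨i, hi⟩ := Function.ne_iff.1 hl0
  exact Finset.sum_neg' (fun j _ => mul_nonpos_of_nonneg_of_nonpos (hl j) (hy j).le)
    ⟨i, Finset.mem_univ _, mul_neg_of_pos_of_neg (lt_of_le_of_ne (hl i) (Ne.symm hi)) (hy i)⟩

theorem mem_convexHull_of_sq_le {n : ℕ} {S : Set (Fin n → ℝ)} {x u : Fin n → ℝ}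
    (hxu : x ^ 2 ≤ u) (hS : ∀ y : Fin n → ℝ, y ^ 2 = u → y ∈ S) : x ∈ convexHull ℝ S := by
  have hu : 0 ≤ u := fun k => (sq_nonneg (x k)).trans (hxu k)
  have hsub : (Set.univ.pi fun k => ({-√(u k), √(u k)} : Set ℝ)) ⊆ S := fun y hy => hS y <| by
    funext k
    rcases hy k (Set.mem_univ k) with h | h
    · simp [h, Real.sq_sqrt (hu k)]
    · rw [Set.mem_singleton_iff] at h
      simp [h, Real.sq_sqrt (hu k)]
  refine convexHull_mono hsub ?_
  rw [convexHull_pi]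
  intro k _
  beta_reduce
  rw [convexHull_pair, segment_eq_Icc (by linarith [Real.sqrt_nonneg (u k)])]
  exact abs_le.1 (Real.abs_le_sqrt (hxu k))

section DiagonalQuadratics

variable {n : ℕ} {ι : Type} (a : Matrix ι (Fin n) ℝ) (c : ι → ℝ)

theorem convexHull_setOf_mulVec_sq_add_neg :
    convexHull ℝ {x : Fin n → ℝ | ∀ i, (a *ᵥ x ^ 2 + c) i < 0} =
      {x | ∃ u, x ^ 2 ≤ u ∧ ∀ i, (a *ᵥ u + c) i < 0} := by
  refine Set.Subset.antisymm (convexHull_min (fun x hx => ⟨x ^ 2, le_rfl, hx⟩) ?_) ?_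
  · rintro x ⟨u, hxu, hu⟩ y ⟨v, hyv, hv⟩ s t hs ht hst
    refine ⟨s • u + t • v, fun k => ?_, fun i => ?_⟩
    · have h1 := hxu k
      have h2 := hyv k
      simp only [Pi.add_apply, Pi.pow_apply, Pi.smul_apply, smul_eq_mul] at h1 h2 ⊢
      have h4 := (even_two.convexOn_pow (𝕜 := ℝ)).2 (Set.mem_univ (x k)) (Set.mem_univ (y k))
        hs ht hst
      simp only [smul_eq_mul] at h4
      exact h4.trans (add_le_add (mul_le_mul_of_nonneg_left h1 hs)
        (mul_le_mul_of_nonneg_left h2 ht))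
    · have h := (convex_Iio (𝕜 := ℝ) (0 : ℝ)) (hu i) (hv i) hs ht hst
      have hc : c i = s * c i + t * c i := by rw [← add_mul, hst, one_mul]
      simp only [mulVec_add, mulVec_smul, Pi.add_apply, Pi.smul_apply, smul_eq_mul,
        Set.mem_Iio] at h ⊢
      linarith
  · rintro x ⟨u, hxu, hu⟩
    exact mem_convexHull_of_sq_le hxu fun y hy i => by rw [hy]; exact hu i

variable {a} [Fintype ι]

theorem convexHull_subset_setOf_dotProduct_neg {l : ι → ℝ} (hl : 0 ≤ l) (hl0 : l ≠ 0)
    (hla : 0 ≤ l ᵥ* a) :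
    convexHull ℝ {x : Fin n → ℝ | ∀ i, (a *ᵥ x ^ 2 + c) i < 0} ⊆
      {x | l ⬝ᵥ (a *ᵥ x ^ 2 + c) < 0} := by
  rw [convexHull_setOf_mulVec_sq_add_neg]
  rintro x ⟨u, hxu, hu⟩
  refine lt_of_le_of_lt ?_ (dotProduct_neg_of_nonneg_of_neg hl hl0 hu)
  rw [dotProduct_add, dotProduct_add, dotProduct_mulVec, dotProduct_mulVec]
  exact add_le_add_left (dotProduct_le_dotProduct_of_nonneg_left hxu hla) _

variable (a) in
theorem exists_finset_convexHull_eq_iInter :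
    ∃ Λ : Finset (ι → ℝ), (∀ l ∈ Λ, 0 ≤ l ∧ l ≠ 0 ∧ 0 ≤ l ᵥ* a) ∧
      convexHull ℝ {x : Fin n → ℝ | ∀ i, (a *ᵥ x ^ 2 + c) i < 0} =
        ⋂ l ∈ Λ, {x | l ⬝ᵥ (a *ᵥ x ^ 2 + c) < 0} := by
  obtain ⟨Λ, hΛ, hd⟩ := exists_finset_certificates n a
  refine ⟨Λ, hΛ, Set.Subset.antisymm (Set.subset_iInter₂ fun l hl =>
    convexHull_subset_setOf_dotProduct_neg c (hΛ l hl).1 (hΛ l hl).2.1 (hΛ l hl).2.2) ?_⟩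
  intro x hx
  obtain ⟨w, hw, h⟩ := hd (a *ᵥ x ^ 2 + c) fun l hl => Set.mem_iInter₂.1 hx l hl
  rw [convexHull_setOf_mulVec_sq_add_neg]
  refine ⟨x ^ 2 + w, le_add_of_nonneg_right hw, fun i => ?_⟩
  have h := h i
  simp only [mulVec_add, Pi.add_apply] at h ⊢
  linarith

variable (a)

theorem setOf_mulVec_sq_add_neg_eq_empty_iff :
    {x : Fin n → ℝ | ∀ i, (a *ᵥ x ^ 2 + c) i < 0} = ∅ ↔
      ∃ l : ι → ℝ, 0 ≤ l ∧ l ≠ 0 ∧ 0 ≤ l ᵥ* a ∧ 0 ≤ l ⬝ᵥ c := by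
  constructor
  · intro h
    obtain ⟨Λ, hΛ, heq⟩ := exists_finset_convexHull_eq_iInter a c
    rw [h, convexHull_empty] at heq
    have h0 : (0 : Fin n → ℝ) ∉ ⋂ l ∈ Λ, {x | l ⬝ᵥ (a *ᵥ x ^ 2 + c) < 0} := by
      rw [← heq]
      exact Set.notMem_empty _
    simp only [Set.mem_iInter, not_forall, Set.mem_ofPred_eq, not_lt] at h0
    obtain ⟨l, hl, hlc⟩ := h0
    refine ⟨l, (hΛ l hl).1, (hΛ l hl).2.1, (hΛ l hl).2.2, ?_⟩
    simpa using hlc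
  · rintro ⟨l, hl, hl0, hla, hlc⟩
    refine Set.eq_empty_of_forall_notMem fun x hx => ?_
    have h : l ⬝ᵥ (a *ᵥ x ^ 2 + c) < 0 := dotProduct_neg_of_nonneg_of_neg hl hl0 hx
    rw [dotProduct_add, dotProduct_mulVec] at h
    have hx2 : 0 ≤ x ^ 2 := fun k => sq_nonneg (x k)
    linarith [dotProduct_nonneg_of_nonneg hla hx2]

theorem convexHull_setOf_mulVec_sq_add_neg_ne_univ_iff
    (hS : {x : Fin n → ℝ | ∀ i, (a *ᵥ x ^ 2 + c) i < 0}.Nonempty) :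
    convexHull ℝ {x : Fin n → ℝ | ∀ i, (a *ᵥ x ^ 2 + c) i < 0} ≠ Set.univ ↔
      ∃ l : ι → ℝ, 0 ≤ l ∧ l ᵥ* a ≠ 0 ∧ 0 ≤ l ᵥ* a := by
  constructor
  · intro h
    obtain ⟨Λ, hΛ, heq⟩ := exists_finset_convexHull_eq_iInter a c
    obtain ⟨x, hx⟩ := (Set.ne_univ_iff_exists_notMem _).1 h
    simp only [heq, Set.mem_iInter, not_forall, Set.mem_ofPred_eq] at hx
    obtain ⟨l, hl, hlx⟩ := hx
    refine ⟨l, (hΛ l hl).1, fun h0 => hlx ?_, (hΛ l hl).2.2⟩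
    obtain ⟨s, hs⟩ := hS
    have h1 : l ⬝ᵥ (a *ᵥ s ^ 2 + c) < 0 :=
      dotProduct_neg_of_nonneg_of_neg (hΛ l hl).1 (hΛ l hl).2.1 hs
    rwa [dotProduct_add, dotProduct_mulVec, h0, zero_dotProduct] at h1 ⊢
  · rintro ⟨l, hl, hne, hla⟩ huniv
    have hl0 : l ≠ 0 := by
      rintro rfl
      exact hne (zero_vecMul a)
    obtain ⟨k, hk⟩ := Function.ne_iff.1 hne
    have hk' : 0 < (l ᵥ* a) k := lt_of_le_of_ne (hla k) (Ne.symm hk)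
    have h := convexHull_subset_setOf_dotProduct_neg c hl hl0 hla
      (huniv ▸ Set.mem_univ (Pi.single k √(|l ⬝ᵥ c| / (l ᵥ* a) k)))
    have hsq : (Pi.single k √(|l ⬝ᵥ c| / (l ᵥ* a) k) : Fin n → ℝ) ^ 2 =
        Pi.single k (|l ⬝ᵥ c| / (l ᵥ* a) k) := by
      funext j
      rcases eq_or_ne j k with rfl | hj
      · rw [Pi.pow_apply, Pi.single_eq_same, Pi.single_eq_same,
          Real.sq_sqrt (div_nonneg (abs_nonneg _) hk'.le)]
      · simp [hj]
    rw [Set.mem_ofPred_eq, hsq, dotProduct_add, dotProduct_mulVec, dotProduct_single,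
      mul_div_cancel₀ _ hk'.ne'] at h
    linarith [neg_abs_le (l ⬝ᵥ c)]

end DiagonalQuadratics

theorem qf_diagonal {n : ℕ} (d : Fin n → ℝ) (c : ℝ) (x : Fin n → ℝ) :
    qf (diagonal d) 0 c x = d ⬝ᵥ x ^ 2 + c := by
  simp only [qf, dotProduct, mulVec_diagonal, Pi.pow_apply, Pi.zero_apply, zero_mul,
    Finset.sum_const_zero, mul_zero, add_zero]
  congr 1
  exact Finset.sum_congr rfl fun k _ => by ring

theorem Qmat_diagonal {n : ℕ} (d : Fin n → ℝ) (c : ℝ) :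
    Qmat (diagonal d) 0 c = Matrix.diagonal (Sum.elim d fun _ => c) := by
  ext (i | i) (j | j) <;> simp [Qmat, diagonal_apply]

theorem sum_smul_diagonal {ι κ : Type} [Fintype ι] [DecidableEq κ] (l : ι → ℝ)
    (d : ι → κ → ℝ) : ∑ i, l i • diagonal (d i) = diagonal (l ᵥ* d) := by
  ext j k
  rcases eq_or_ne j k with rfl | h
  · simp [Matrix.sum_apply, vecMul, dotProduct]
  · simp [Matrix.sum_apply, h]

/-- Sets given by diagonal quadratics: aggregation certificates for emptiness, for
`conv(S) ≠ ℝⁿ`, and a finite aggregation description of the convex hull. -/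
theorem statement5 (n m : ℕ) (hn : 2 ≤ n)
    (A : Fin m → Matrix (Fin n) (Fin n) ℝ) (b : Fin m → Fin n → ℝ) (c : Fin m → ℝ)
    (hdiag : ∀ i, (A i).IsDiag) (hb : ∀ i, b i = 0) :
    (Sset A b c = ∅ ↔ ∃ lam : Fin m → ℝ, 0 ≤ lam ∧ lam ≠ 0 ∧
        (∑ i, lam i • Qmat (A i) (b i) (c i)).PosSemidef) ∧
    ((Sset A b c).Nonempty →
      (convexHull ℝ (Sset A b c) ≠ Set.univ ↔ ∃ lam : Fin m → ℝ, 0 ≤ lam ∧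
        (∑ i, lam i • A i) ≠ 0 ∧ (∑ i, lam i • A i).PosSemidef)) ∧
    ((Sset A b c).Nonempty → convexHull ℝ (Sset A b c) ≠ Set.univ →
      ∃ (k : ℕ) (lams : Fin k → Fin m → ℝ),
        (∀ j, 0 ≤ lams j ∧ lams j ≠ 0 ∧ (∑ i, lams j i • A i).PosSemidef) ∧
        convexHull ℝ (Sset A b c) = ⋂ j, Sagg A b c (lams j)) := by
  obtain ⟨a, rfl⟩ : ∃ a : Fin m → Fin n → ℝ, A = fun i => Matrix.diagonal (a i) :=
    ⟨fun i => (A i).diag, funext fun i => (hdiag i).diagonal_diag.symm⟩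
  obtain rfl : b = 0 := funext hb
  have hS : Sset (fun i => Matrix.diagonal (a i)) 0 c = {x | ∀ i, (of a *ᵥ x ^ 2 + c) i < 0} := by
    ext x
    simp only [Sset, Pi.zero_apply, qf_diagonal]
    rfl
  have hSagg (l : Fin m → ℝ) : Sagg (fun i => Matrix.diagonal (a i)) 0 c l =
      {x | l ⬝ᵥ (of a *ᵥ x ^ 2 + c) < 0} := by
    ext x
    simp only [Sagg, Pi.zero_apply, qf_diagonal]
    rfl
  have hpsd (l : Fin m → ℝ) : (∑ i, l i • diagonal (a i)).PosSemidef ↔ 0 ≤ l ᵥ* of a := by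
    rw [sum_smul_diagonal, posSemidef_diagonal_iff]
    rfl
  have hQ (l : Fin m → ℝ) :
      (∑ i, l i • Qmat (diagonal (a i)) ((0 : Fin m → Fin n → ℝ) i) (c i)).PosSemidef ↔
        0 ≤ l ᵥ* of a ∧ 0 ≤ l ⬝ᵥ c := by
    simp only [Pi.zero_apply, Qmat_diagonal]
    rw [sum_smul_diagonal, posSemidef_diagonal_iff, Sum.forall]
    exact and_congr Iff.rfl ⟨fun h => h (), fun h _ => h⟩
  rw [hS]
  refine ⟨?_, fun hne => ?_, fun _ _ => ?_⟩
  · simp only [hQ]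
    exact setOf_mulVec_sq_add_neg_eq_empty_iff (of a) c
  · rw [convexHull_setOf_mulVec_sq_add_neg_ne_univ_iff (of a) c hne]
    refine exists_congr fun l => ?_
    rw [hpsd, sum_smul_diagonal, ne_eq, ne_eq, diagonal_eq_zero]
    rfl
  · obtain ⟨Λ, hΛ, heq⟩ := exists_finset_convexHull_eq_iInter (of a) c
    refine ⟨Λ.card, fun j => Λ.equivFin.symm j, fun j => ?_, ?_⟩
    · rw [hpsd]
      exact hΛ _ (Λ.equivFin.symm j).2
    · simp only [hSagg]
      rw [heq]
      ext x
      simp only [Set.mem_iInter]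
      exact ⟨fun h j => h _ (Λ.equivFin.symm j).2,
        fun h l hl => by simpa using h (Λ.equivFin ⟨l, hl⟩)⟩

end
end

section
/- Let f_1,…,f_m be quadratic functions f_i(x) = xᵀA_ix + 2b_iᵀx + c_i on ℝⁿ and let E = {(x, x_{n+1}) ∈ ℝ^{n+1} : x_{n+1} = 0}. Assume the image of the restriction of the homogeneous quadratic map f^h to E is convex (equivalently, the image of the quadratic map x ↦ (xᵀA_1x,…,xᵀA_mx) is convex). If there does not exist a nonzero λ ∈ ℝᵐ, λ ≥ 0, with Σᵢ λ_iA_i positive semidefinite, then conv(S) = ℝⁿ, where S = {x ∈ ℝⁿ : f_i(x) < 0 for all i ∈ [m]}. -/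
open Matrix Set

noncomputable section

/-- If no nonzero nonnegative combination of the `A i` is positive semidefinite and the joint
numerical image is convex, some direction makes all the quadratic forms negative. -/
lemma exists_forall_quadForm_neg {n m : ℕ} (A : Fin m → Matrix (Fin n) (Fin n) ℝ)
    (hsymm : ∀ i, (A i).IsSymm) (hconv : Convex ℝ (quadImage A Set.univ))
    (hnopsd : ¬ ∃ lam : Fin m → ℝ, 0 ≤ lam ∧ lam ≠ 0 ∧ (∑ i, lam i • A i).PosSemidef) :
    ∃ v : Fin n → ℝ, ∀ i, v ⬝ᵥ (A i).mulVec v < 0 := by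
  by_contra! hv
  let s : Set (Fin m → ℝ) := Set.univ.pi fun _ => Set.Iio 0
  have hs : Convex ℝ s := convex_pi fun _ _ => convex_Iio 0
  have hso : IsOpen s := isOpen_set_pi Set.finite_univ fun _ _ => isOpen_Iio
  have hdisj : Disjoint s (quadImage A Set.univ) := by
    rw [Set.disjoint_left]
    rintro _ hy ⟨v, -, rfl⟩
    obtain ⟨i, hi⟩ := hv v
    exact absurd (hy i trivial) (not_lt.mpr hi)
  obtain ⟨f, u, hfs, hft⟩ := geometric_hahn_banach_open hs hso hconv hdisj
  have hu_nonpos : u ≤ 0 := by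
    simpa [← Pi.zero_def] using hft _ ⟨0, trivial, rfl⟩
  have hone : f (-1) < u := hfs _ fun i _ => by simp
  have hu_nonneg : 0 ≤ u := by
    by_contra! hu
    have hf : f (-1) < 0 := hone.trans hu
    have hpos : 0 < u / (2 * f (-1)) := div_pos_of_neg_of_neg hu (by linarith)
    have h := hfs ((u / (2 * f (-1))) • (-1)) fun i _ => by simpa using hpos
    rw [map_smul, smul_eq_mul] at h
    have : u / (2 * f (-1)) * f (-1) = u / 2 := by
      rw [div_mul_eq_mul_div, mul_comm 2, mul_comm u, mul_div_mul_left _ _ hf.ne]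
    linarith
  have hsum (y : Fin m → ℝ) : f y = ∑ i, y i * f (Pi.single i 1) := by
    have h := f.toLinearMap.pi_apply_eq_sum_univ y
    have hsingle (i : Fin m) : (fun j => if i = j then (1 : ℝ) else 0) = Pi.single i 1 := by
      ext j
      simp [Pi.single_apply, eq_comm]
    simpa [hsingle] using h
  refine hnopsd ⟨fun i => f (Pi.single i 1), fun i => ?_, fun h0 => ?_, ?_⟩
  · by_contra! hi
    simp only [Pi.zero_apply] at hi
    have hr : 0 ≤ (u - f (-1)) / (-f (Pi.single i 1)) :=
      div_nonneg (by linarith) (by linarith)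
    have h := hfs (-1 - ((u - f (-1)) / (-f (Pi.single i 1))) • Pi.single i 1) fun j _ => by
      by_cases hj : j = i
      · subst hj
        simp only [Set.mem_Iio, Pi.sub_apply, Pi.neg_apply, Pi.one_apply, Pi.smul_apply,
          Pi.single_eq_same, smul_eq_mul, mul_one]
        linarith
      · simp [hj]
    rw [map_sub, map_smul, smul_eq_mul] at h
    have : (u - f (-1)) / (-f (Pi.single i 1)) * f (Pi.single i 1) = -(u - f (-1)) := by
      field_simp [hi.ne]
    linarith
  · have h (i : Fin m) : f (Pi.single i 1) = 0 := congrFun h0 i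
    have : f (-1) = 0 := by
      rw [hsum]
      simp only [h, mul_zero, Finset.sum_const_zero]
    linarith
  · refine Matrix.PosSemidef.of_dotProduct_mulVec_nonneg ?_ fun x => ?_
    · simp [Matrix.IsHermitian, Matrix.transpose_sum, fun i => (hsymm i).eq]
    · have h := hu_nonneg.trans (hft _ ⟨x, trivial, rfl⟩)
      rw [hsum] at h
      simpa [Matrix.sum_mulVec, dotProduct_sum, Matrix.smul_mulVec, mul_comm] using h

/-- Along a direction of negative curvature a quadratic function is eventually negative. -/
lemma eventually_qf_add_smul_neg {n : ℕ} (A : Matrix (Fin n) (Fin n) ℝ) (b : Fin n → ℝ) (c : ℝ)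
    (x : Fin n → ℝ) {v : Fin n → ℝ} (hv : v ⬝ᵥ A.mulVec v < 0) :
    ∀ᶠ t : ℝ in Filter.atTop, qf A b c (x + t • v) < 0 := by
  set q := v ⬝ᵥ A.mulVec v with hq
  set l := x ⬝ᵥ A.mulVec v + v ⬝ᵥ A.mulVec x + 2 * (b ⬝ᵥ v) with hl
  have hexp (t : ℝ) : qf A b c (x + t • v) = t * (t * q + l) + qf A b c x := by
    simp only [qf, hq, hl, Matrix.mulVec_add, Matrix.mulVec_smul, dotProduct_add, add_dotProduct,
      dotProduct_smul, smul_dotProduct, smul_eq_mul]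
    ring
  have hlim : Filter.Tendsto (fun t : ℝ => t * (t * q + l) + qf A b c x)
      Filter.atTop Filter.atBot :=
    Filter.tendsto_atBot_add_const_right _ _ <|
      Filter.tendsto_id.atTop_mul_atBot₀ <|
        Filter.tendsto_atBot_add_const_right _ _ <|
          Filter.tendsto_id.atTop_mul_const_of_neg hv
  simpa only [hexp] using hlim.eventually_lt_atBot 0

/-- If the image of `x ↦ (xᵀA₁x,…,xᵀA_mx)` is convex and no nonnegative nonzero
combination of the `Aᵢ` is PSD, then `conv(S) = ℝⁿ`. -/
theorem statement7 (n m : ℕ)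
    (A : Fin m → Matrix (Fin n) (Fin n) ℝ) (b : Fin m → Fin n → ℝ) (c : Fin m → ℝ)
    (hsymm : ∀ i, (A i).IsSymm)
    (hconv : Convex ℝ (quadImage A Set.univ))
    (hnopsd : ¬ ∃ lam : Fin m → ℝ, 0 ≤ lam ∧ lam ≠ 0 ∧ (∑ i, lam i • A i).PosSemidef) :
    convexHull ℝ (Sset A b c) = Set.univ := by
  obtain ⟨v, hv⟩ := exists_forall_quadForm_neg A hsymm hconv hnopsd
  refine Set.eq_univ_of_forall fun x => ?_
  have hpos := Filter.eventually_all.mpr fun i =>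
    eventually_qf_add_smul_neg (A i) (b i) (c i) x (hv i)
  have hneg := Filter.eventually_all.mpr fun i =>
    eventually_qf_add_smul_neg (A i) (b i) (c i) x (v := -v)
      (by simpa [Matrix.mulVec_neg] using hv i)
  obtain ⟨t, htp, htn⟩ := (hpos.and hneg).exists
  have hmid := (convex_convexHull ℝ (Sset A b c)).midpoint_mem
    (subset_convexHull ℝ _ htp) (subset_convexHull ℝ _ htn)
  rwa [smul_neg, ← sub_eq_add_neg, midpoint_add_sub] at hmid

end
end
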